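/- arXiv:1506.05520 — 4 statements merged into one kernel-verified Lean document; each statement's English description precedes it below -/
import Mathlib

section
/- The energy J is Lipschitz continuous on (X_R, d_w): there exists a constant L (depending only on R_v and R) such that |J(ν) − J(θ)| ≤ L·d_w(ν, θ) for all ν, θ ∈ X_R. More precisely, writing J = (1/4)J₀ + J₁ with J₀(ν) = ∫∫ |x − y| d(ν⊗μ)(a,x) d(ν⊗μ)(b,y) and J₁(ν) = ∫ (1/2 − a)x d(ν⊗μ)(a,x), one has |J₀(ν) − J₀(θ)| ≤ 2·d_w(ν, θ), and J₁ is Lipschitz for d_w. -/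
open MeasureTheory Filter

noncomputable section

/-- Optimal transport cost between two Borel measures on `E` for the cost `c`:
the infimum of `∫ c(x,y) dγ` over all transport plans `γ` with marginals `ν` and `θ`. -/
def Wcost {E : Type*} [MeasurableSpace E] (c : E → E → ℝ) (ν θ : Measure E) : ℝ :=
  sInf { r : ℝ | ∃ γ : Measure (E × E),
    γ.map Prod.fst = ν ∧ γ.map Prod.snd = θ ∧ r = ∫ p, c p.1 p.2 ∂γ }

/-- Squared 2-Wasserstein distance between measures (of equal mass) on `ℝ`. -/
def W2sq (ν θ : Measure ℝ) : ℝ := Wcost (fun x y => (x - y) ^ 2) ν θ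

/-- Squared 2-Wasserstein distance between measures on `ℝ × ℝ` (Euclidean cost). -/
def W2sqProd (ν θ : Measure (ℝ × ℝ)) : ℝ :=
  Wcost (fun p q => (p.1 - q.1) ^ 2 + (p.2 - q.2) ^ 2) ν θ

/-- The measure `ν ⊗ μ` on `A × ℝ` associated with a family `ν = (ν^a)` of measures on `ℝ`:
`∫ φ d(ν⊗μ) = ∫_A ∫_ℝ φ(a,x) dν^a(x) dμ(a)`. -/
def nuOtimes (μ : Measure ℝ) (ν : ℝ → Measure ℝ) : Measure (ℝ × ℝ) :=
  μ.bind fun a => (ν a).map fun x => (a, x)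

/-- Membership in `X_R`: a `μ`-measurable family `ν = (ν^a)` of nonnegative measures on `ℝ`
with total mass `h a` for `μ`-a.e. `a` and support in `[-R, R]` for `μ`-a.e. `a`. -/
structure IsXR (μ : Measure ℝ) (h : ℝ → ℝ) (R : ℝ) (ν : ℝ → Measure ℝ) : Prop where
  meas : ∀ s : Set ℝ, MeasurableSet s → Measurable fun a => ν a s
  mass : ∀ᵐ a ∂μ, ν a Set.univ = ENNReal.ofReal (h a)
  supp : ∀ᵐ a ∂μ, ν a ((Set.Icc (-R) R)ᶜ) = 0

/-- The measure `ν̄ = ∫_A ν^a dμ(a)` (second marginal of `ν ⊗ μ`). -/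
def barNu (μ : Measure ℝ) (ν : ℝ → Measure ℝ) : Measure ℝ := (nuOtimes μ ν).map Prod.snd

/-- The interaction part `J₀(ν) = ∫∫ |x−y| d(ν⊗μ)(a,x) d(ν⊗μ)(b,y)`. -/
def J0 (μ : Measure ℝ) (ν : ℝ → Measure ℝ) : ℝ :=
  ∫ q, |q.1.2 - q.2.2| ∂((nuOtimes μ ν).prod (nuOtimes μ ν))

/-- The potential part `J₁(ν) = ∫ (1/2 − a)·x d(ν⊗μ)(a,x)`. -/
def J1 (μ : Measure ℝ) (ν : ℝ → Measure ℝ) : ℝ :=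
  ∫ p, (1 / 2 - p.1) * p.2 ∂(nuOtimes μ ν)

/-- The energy `J = (1/4)·J₀ + J₁`. -/
def Jen (μ : Measure ℝ) (ν : ℝ → Measure ℝ) : ℝ := (1 / 4) * J0 μ ν + J1 μ ν

/-- The squared distance `d²(ν, θ) = ∫_A W₂²(ν^a, θ^a) dμ(a)` on `X_R`. -/
def dsq (μ : Measure ℝ) (ν θ : ℝ → Measure ℝ) : ℝ := ∫ a, W2sq (ν a) (θ a) ∂μ

/-- The weak distance `d_w(ν, θ) = W₂(ν⊗μ, θ⊗μ)`. -/
def dw (μ : Measure ℝ) (ν θ : ℝ → Measure ℝ) : ℝ :=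
  Real.sqrt (W2sqProd (nuOtimes μ ν) (nuOtimes μ θ))

/-- A `μ`-measurable family of transport plans `γ^a ∈ Π(ν^a, θ^a)`. -/
structure IsPlanFamily (μ : Measure ℝ) (ν θ : ℝ → Measure ℝ)
    (γ : ℝ → Measure (ℝ × ℝ)) : Prop where
  meas : ∀ s : Set (ℝ × ℝ), MeasurableSet s → Measurable fun a => γ a s
  fst : ∀ᵐ a ∂μ, (γ a).map Prod.fst = ν a
  snd : ∀ᵐ a ∂μ, (γ a).map Prod.snd = θ a

/-- `w ∈ ∂J(ν)`: `w ∈ L¹(ν⊗μ)` and for every `R' > 0`, every `θ ∈ X_{R'}` and every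
`μ`-measurable family of plans `γ^a ∈ Π(ν^a, θ^a)`,
`J(θ) − J(ν) ≥ ∫_A ∫ w^a(y)(z − y) dγ^a(y,z) dμ(a)`. -/
def InSubdiff (μ : Measure ℝ) (h : ℝ → ℝ) (ν : ℝ → Measure ℝ) (w : ℝ → ℝ → ℝ) : Prop :=
  Integrable (fun p : ℝ × ℝ => w p.1 p.2) (nuOtimes μ ν) ∧
  ∀ R' : ℝ, 0 < R' → ∀ θ : ℝ → Measure ℝ, IsXR μ h R' θ →
    ∀ γ : ℝ → Measure (ℝ × ℝ), IsPlanFamily μ ν θ γ →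
      Jen μ θ - Jen μ ν ≥ ∫ a, (∫ p : ℝ × ℝ, w a p.1 * (p.2 - p.1) ∂(γ a)) ∂μ

/-- Cumulative distribution function `G(x) = ρ((−∞, x])` of `ρ = ∫_A ν^a dμ(a)`. -/
def Gcdf (μ : Measure ℝ) (ν : ℝ → Measure ℝ) (x : ℝ) : ℝ := (barNu μ ν (Set.Iic x)).toReal

/-- Left-continuous version `G⁻(x) = ρ((−∞, x))`. -/
def GcdfM (μ : Measure ℝ) (ν : ℝ → Measure ℝ) (x : ℝ) : ℝ := (barNu μ ν (Set.Iio x)).toReal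

/-- The curve `t ↦ ν_t` solves the continuity equation `∂ₜν + ∂ₓ(ν v) = 0` on `[0,T]`
in the sense of distributions. -/
def SolvesContinuity (T : ℝ) (νa : ℝ → Measure ℝ) (va : ℝ → ℝ → ℝ) : Prop :=
  ∀ φ : ℝ → ℝ → ℝ, ContDiff ℝ 1 (Function.uncurry φ) →
    HasCompactSupport (Function.uncurry φ) →
    (∫ t in Set.Icc (0 : ℝ) T,
        ∫ x, (deriv (fun s => φ s x) t + deriv (fun y => φ t y) x * va t x) ∂(νa t))
      = (∫ x, φ T x ∂(νa T)) - ∫ x, φ 0 x ∂(νa 0)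

/-- A gradient flow of `J` on `[0,T]` starting from `ν₀`: a Lipschitz (for `d`) curve
`t ↦ ν(t) ∈ X_R` with a velocity `v(t) ∈ −∂J(ν(t))` for a.e. `t`, such that for `μ`-a.e.
label `a` the curve `t ↦ ν(t)^a` solves the continuity equation with velocity `v^a`. -/
structure IsGradientFlow (μ : Measure ℝ) (h : ℝ → ℝ) (R T : ℝ)
    (ν : ℝ → ℝ → Measure ℝ) (v : ℝ → ℝ → ℝ → ℝ) (ν₀ : ℝ → Measure ℝ) : Prop where
  init : ν 0 = ν₀
  mem : ∀ t ∈ Set.Icc (0 : ℝ) T, IsXR μ h R (ν t)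
  lip : ∃ L : ℝ, ∀ s ∈ Set.Icc (0 : ℝ) T, ∀ t ∈ Set.Icc (0 : ℝ) T,
    Real.sqrt (dsq μ (ν s) (ν t)) ≤ L * |t - s|
  vmeas : Measurable fun p : ℝ × ℝ × ℝ => v p.1 p.2.1 p.2.2
  subdiff : ∀ᵐ t ∂(volume.restrict (Set.Icc (0 : ℝ) T)),
    InSubdiff μ h (ν t) fun a x => -(v t a x)
  cont : ∀ᵐ a ∂μ, SolvesContinuity T (fun t => ν t a) fun t => v t a

end

open ProbabilityTheory

/-- The map `a ↦ δ_a ⊗ ν^a` is a.e. measurable when `ν^a` is finite for a.e. `a`. -/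
lemma IsXR.aemeasurable_map {μ : Measure ℝ} {h : ℝ → ℝ} {R : ℝ} {ν : ℝ → Measure ℝ}
    (hν : IsXR μ h R ν) : AEMeasurable (fun a => (ν a).map fun x => (a, x)) μ := by
  classical
  have hνm : Measurable ν := Measure.measurable_of_measurable_coe _ hν.meas
  have hS : MeasurableSet {a | ν a Set.univ < ⊤} :=
    measurableSet_lt (hν.meas _ MeasurableSet.univ) measurable_const
  let κ : Kernel ℝ ℝ :=
    ⟨fun a => if ν a Set.univ < ⊤ then ν a else 0, Measurable.ite hS hνm measurable_const⟩
  have hκ : ∀ a, κ a = if ν a Set.univ < ⊤ then ν a else 0 := fun _ => rfl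
  have hfin : ∀ a, IsFiniteMeasure (κ a) := by
    intro a
    rw [hκ]
    split_ifs with ha
    · exact ⟨ha⟩
    · infer_instance
  refine ⟨fun a => (κ a).map fun x => (a, x), ?_, ?_⟩
  · refine Measure.measurable_of_measurable_coe _ fun s hs => ?_
    have := fun a => Measure.map_apply (μ := κ a) (measurable_prodMk_left (x := a)) hs
    simp_rw [this]
    exact Kernel.measurable_kernel_prodMk_left_of_finite hs hfin
  · filter_upwards [hν.mass] with a ha
    rw [hκ, if_pos (by rw [ha]; exact ENNReal.ofReal_lt_top)]

lemma IsXR.isProbabilityMeasure {μ : Measure ℝ} {h : ℝ → ℝ} {R : ℝ} {ν : ℝ → Measure ℝ}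
    (hν : IsXR μ h R ν) (h0 : ∀ a, 0 ≤ h a) (hi : Integrable h μ) (h1 : ∫ a, h a ∂μ = 1) :
    IsProbabilityMeasure (nuOtimes μ ν) := by
  refine ⟨?_⟩
  rw [nuOtimes, Measure.bind_apply MeasurableSet.univ hν.aemeasurable_map]
  have : ∫⁻ a, ((ν a).map fun x => (a, x)) Set.univ ∂μ = ∫⁻ a, ENNReal.ofReal (h a) ∂μ := by
    refine lintegral_congr_ae ?_
    filter_upwards [hν.mass] with a ha
    rw [Measure.map_apply measurable_prodMk_left MeasurableSet.univ, Set.preimage_univ, ha]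
  rw [this, ← ofReal_integral_eq_lintegral_ofReal hi (ae_of_all _ h0), h1, ENNReal.ofReal_one]

lemma IsXR.ae_mem {μ : Measure ℝ} {h : ℝ → ℝ} {R : ℝ} {ν : ℝ → Measure ℝ}
    (hν : IsXR μ h R ν) {A : Set ℝ} (hA : MeasurableSet A) (hμ : μ Aᶜ = 0) :
    ∀ᵐ p ∂(nuOtimes μ ν), p ∈ A ×ˢ Set.Icc (-R) R := by
  have hm : MeasurableSet (A ×ˢ Set.Icc (-R) R)ᶜ := (hA.prod measurableSet_Icc).compl
  change nuOtimes μ ν (A ×ˢ Set.Icc (-R) R)ᶜ = 0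
  rw [nuOtimes, Measure.bind_apply hm hν.aemeasurable_map]
  refine lintegral_eq_zero_of_ae_eq_zero ?_
  filter_upwards [hν.supp, show ∀ᵐ a ∂μ, a ∈ A from hμ] with a ha haA
  rw [Measure.map_apply measurable_prodMk_left hm]
  refine measure_mono_null (fun x hx => ?_) ha
  simpa [haA] using hx

/-- A bound valid for the cost of every plan passes to the Wasserstein distance. -/
lemma le_mul_sqrt_Wcost {E : Type*} [MeasurableSpace E] {c : E → E → ℝ} {ν θ : Measure E}
    [IsProbabilityMeasure ν] [IsProbabilityMeasure θ] {D L : ℝ}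
    (hc : ∀ x y, 0 ≤ c x y) (hD : 0 ≤ D) (hL : 0 < L)
    (H : ∀ γ : Measure (E × E), IsProbabilityMeasure γ → γ.map Prod.fst = ν →
      γ.map Prod.snd = θ → D ≤ L * √(∫ p, c p.1 p.2 ∂γ)) :
    D ≤ L * √(Wcost c ν θ) := by
  rw [← div_le_iff₀' hL]
  refine Real.le_sqrt_of_sq_le (le_csInf ?_ ?_)
  · exact ⟨_, ν.prod θ, by simp, by simp, rfl⟩
  · rintro _ ⟨γ, h1, h2, rfl⟩
    have hγ : IsProbabilityMeasure γ := by
      refine ⟨?_⟩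
      rw [← Set.preimage_univ (f := Prod.fst), ← Measure.map_apply measurable_fst .univ, h1,
        measure_univ]
    exact (Real.le_sqrt (div_nonneg hD hL.le)
      (integral_nonneg fun p : E × E => hc p.1 p.2)).1 ((div_le_iff₀' hL).2 (H γ hγ h1 h2))

lemma integral_sqrt_le_sqrt_integral {Ω : Type*} [MeasurableSpace Ω] {γ : Measure Ω}
    [IsProbabilityMeasure γ] {f : Ω → ℝ} (hf : ∀ ω, 0 ≤ f ω) (hm : AEStronglyMeasurable f γ)
    (hi : Integrable f γ) : ∫ ω, √(f ω) ∂γ ≤ √(∫ ω, f ω ∂γ) := by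
  have hL : MemLp (fun ω => √(f ω)) 2 γ := by
    rw [memLp_two_iff_integrable_sq (Real.continuous_sqrt.comp_aestronglyMeasurable hm)]
    simpa only [Real.sq_sqrt (hf _)] using hi
  have := variance_nonneg (fun ω => √(f ω)) γ
  rw [variance_eq_sub hL] at this
  simp only [Pi.pow_apply, Real.sq_sqrt (hf _)] at this
  exact Real.le_sqrt_of_sq_le (by linarith)

/-- A continuous function is integrable for a coupling concentrated on a bounded set. -/
lemma integrable_of_ae_mem_bounded {γ : Measure ((ℝ × ℝ) × (ℝ × ℝ))} [IsProbabilityMeasure γ] {S : Set (ℝ × ℝ)}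
    (hS : Bornology.IsBounded S) (h1 : ∀ᵐ p ∂γ, p.1 ∈ S) (h2 : ∀ᵐ p ∂γ, p.2 ∈ S)
    {f : (ℝ × ℝ) × (ℝ × ℝ) → ℝ} (hf : Continuous f) : Integrable f γ := by
  obtain ⟨C, hC⟩ := (hS.isCompact_closure.prod hS.isCompact_closure).exists_bound_of_continuousOn
    hf.continuousOn
  refine Integrable.of_bound hf.aestronglyMeasurable C ?_
  filter_upwards [h1, h2] with p hp1 hp2
  exact hC p ⟨subset_closure hp1, subset_closure hp2⟩

lemma abs_J1_sub_le (Rv R : ℝ) (hRv : 0 < Rv) (hR : 0 < R) (μ : Measure ℝ) (h : ℝ → ℝ)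
    (hμ : μ ((Set.Icc (-Rv) (Rv + 1))ᶜ) = 0) (h0 : ∀ a, 0 ≤ h a) (hi : Integrable h μ)
    (h1 : ∫ a, h a ∂μ = 1) (ν θ : ℝ → Measure ℝ) (hν : IsXR μ h R ν) (hθ : IsXR μ h R θ) :
    |J1 μ ν - J1 μ θ| ≤ (Rv + 1 / 2 + R) * dw μ ν θ := by
  have := hν.isProbabilityMeasure h0 hi h1
  have := hθ.isProbabilityMeasure h0 hi h1
  refine le_mul_sqrt_Wcost (fun _ _ => by positivity) (abs_nonneg _) (by positivity)
    fun γ hγ hfst hsnd => ?_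
  have hN := hν.ae_mem measurableSet_Icc hμ
  have hΘ := hθ.ae_mem measurableSet_Icc hμ
  rw [← hfst] at hN
  rw [← hsnd] at hΘ
  replace hN := ae_of_ae_map measurable_fst.aemeasurable hN
  replace hΘ := ae_of_ae_map measurable_snd.aemeasurable hΘ
  have hint : ∀ {f : (ℝ × ℝ) × (ℝ × ℝ) → ℝ}, Continuous f → Integrable f γ := fun hf =>
    integrable_of_ae_mem_bounded ((Metric.isBounded_Icc _ _).prod (Metric.isBounded_Icc _ _)) hN hΘ hf
  have hg : Continuous fun p : ℝ × ℝ => (1 / 2 - p.1) * p.2 := by fun_prop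
  rw [J1, J1, ← hfst, ← hsnd, integral_map measurable_fst.aemeasurable hg.aestronglyMeasurable,
    integral_map measurable_snd.aemeasurable hg.aestronglyMeasurable,
    ← integral_sub (hint (by fun_prop)) (hint (by fun_prop))]
  refine (abs_integral_le_integral_abs).trans ?_
  have hs := integral_sqrt_le_sqrt_integral (γ := γ)
    (f := fun p => (p.1.1 - p.2.1) ^ 2 + (p.1.2 - p.2.2) ^ 2) (fun _ => by positivity)
    (Continuous.aestronglyMeasurable (by fun_prop)) (hint (by fun_prop))
  refine le_trans ?_ (mul_le_mul_of_nonneg_left hs (by positivity))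
  rw [← integral_const_mul]
  refine integral_mono_ae (hint (by fun_prop)) (hint (by fun_prop)) ?_
  filter_upwards [hN, hΘ] with p hp hq
  obtain ⟨⟨ha, ha'⟩, hx, hx'⟩ := hp
  obtain ⟨⟨hb, hb'⟩, hy, hy'⟩ := hq
  have hd1 : |p.1.1 - p.2.1| ≤ √((p.1.1 - p.2.1) ^ 2 + (p.1.2 - p.2.2) ^ 2) :=
    Real.abs_le_sqrt (by nlinarith [sq_nonneg (p.1.2 - p.2.2)])
  have hd2 : |p.1.2 - p.2.2| ≤ √((p.1.1 - p.2.1) ^ 2 + (p.1.2 - p.2.2) ^ 2) :=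
    Real.abs_le_sqrt (by nlinarith [sq_nonneg (p.1.1 - p.2.1)])
  have hA : |1 / 2 - p.1.1| ≤ Rv + 1 / 2 := abs_le.2 ⟨by linarith, by linarith⟩
  have hY : |p.2.2| ≤ R := abs_le.2 ⟨hy, hy'⟩
  calc |(1 / 2 - p.1.1) * p.1.2 - (1 / 2 - p.2.1) * p.2.2|
      = |(1 / 2 - p.1.1) * (p.1.2 - p.2.2) - p.2.2 * (p.1.1 - p.2.1)| := by congr 1; ring
    _ ≤ |1 / 2 - p.1.1| * |p.1.2 - p.2.2| + |p.2.2| * |p.1.1 - p.2.1| := by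
        rw [← abs_mul, ← abs_mul]; exact abs_sub _ _
    _ ≤ (Rv + 1 / 2) * √((p.1.1 - p.2.1) ^ 2 + (p.1.2 - p.2.2) ^ 2)
        + R * √((p.1.1 - p.2.1) ^ 2 + (p.1.2 - p.2.2) ^ 2) := by gcongr
    _ = _ := by ring

lemma abs_J0_sub_le (Rv R : ℝ) (μ : Measure ℝ) (h : ℝ → ℝ)
    (hμ : μ ((Set.Icc (-Rv) (Rv + 1))ᶜ) = 0) (h0 : ∀ a, 0 ≤ h a) (hi : Integrable h μ)
    (h1 : ∫ a, h a ∂μ = 1) (ν θ : ℝ → Measure ℝ) (hν : IsXR μ h R ν) (hθ : IsXR μ h R θ) :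
    |J0 μ ν - J0 μ θ| ≤ 2 * dw μ ν θ := by
  have := hν.isProbabilityMeasure h0 hi h1
  have := hθ.isProbabilityMeasure h0 hi h1
  refine le_mul_sqrt_Wcost (fun _ _ => by positivity) (abs_nonneg _) two_pos
    fun γ hγ hfst hsnd => ?_
  have hN := hν.ae_mem measurableSet_Icc hμ
  have hΘ := hθ.ae_mem measurableSet_Icc hμ
  rw [← hfst] at hN
  rw [← hsnd] at hΘ
  replace hN := ae_of_ae_map measurable_fst.aemeasurable hN
  replace hΘ := ae_of_ae_map measurable_snd.aemeasurable hΘ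
  have hint : ∀ {f : (ℝ × ℝ) × (ℝ × ℝ) → ℝ}, Continuous f → Integrable f γ := fun hf =>
    integrable_of_ae_mem_bounded ((Metric.isBounded_Icc _ _).prod (Metric.isBounded_Icc _ _)) hN hΘ hf
  have hs := integral_sqrt_le_sqrt_integral (γ := γ)
    (f := fun p => (p.1.1 - p.2.1) ^ 2 + (p.1.2 - p.2.2) ^ 2) (fun _ => by positivity)
    (Continuous.aestronglyMeasurable (by fun_prop)) (hint (by fun_prop))
  have hx1 : Integrable (fun p : (ℝ × ℝ) × (ℝ × ℝ) => p.1.2) γ := hint (by fun_prop)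
  have hx2 : Integrable (fun p : (ℝ × ℝ) × (ℝ × ℝ) => p.2.2) γ := hint (by fun_prop)
  have hg : Continuous fun q : (ℝ × ℝ) × (ℝ × ℝ) => |q.1.2 - q.2.2| := by fun_prop
  have hdiff : Integrable (fun p : (ℝ × ℝ) × (ℝ × ℝ) => |p.1.2 - p.2.2|) γ := hint hg
  have hi1 : Integrable (fun q : ((ℝ × ℝ) × (ℝ × ℝ)) × ((ℝ × ℝ) × (ℝ × ℝ)) =>
      |(Prod.map Prod.fst Prod.fst q).1.2 - (Prod.map Prod.fst Prod.fst q).2.2|) (γ.prod γ) :=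
    ((hx1.comp_fst γ).sub (hx1.comp_snd γ)).abs
  have hi2 : Integrable (fun q : ((ℝ × ℝ) × (ℝ × ℝ)) × ((ℝ × ℝ) × (ℝ × ℝ)) =>
      |(Prod.map Prod.snd Prod.snd q).1.2 - (Prod.map Prod.snd Prod.snd q).2.2|) (γ.prod γ) :=
    ((hx2.comp_fst γ).sub (hx2.comp_snd γ)).abs
  rw [J0, J0, ← hfst, ← hsnd, Measure.map_prod_map _ _ measurable_fst measurable_fst,
    Measure.map_prod_map _ _ measurable_snd measurable_snd,
    integral_map (measurable_fst.prodMap measurable_fst).aemeasurable hg.aestronglyMeasurable,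
    integral_map (measurable_snd.prodMap measurable_snd).aemeasurable hg.aestronglyMeasurable,
    ← integral_sub hi1 hi2]
  refine (abs_integral_le_integral_abs).trans ?_
  calc _ ≤ ∫ q, |q.1.1.2 - q.1.2.2| + |q.2.1.2 - q.2.2.2| ∂(γ.prod γ) := by
        refine integral_mono (hi1.sub hi2).abs
          ((hdiff.comp_fst γ).add (hdiff.comp_snd γ)) fun q => ?_
        refine (abs_abs_sub_abs_le _ _).trans ?_
        refine le_trans (le_of_eq ?_) (abs_sub (q.1.1.2 - q.1.2.2) (q.2.1.2 - q.2.2.2))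
        simp only [Prod.map_fst, Prod.map_snd]
        congr 1
        ring
    _ = 2 * ∫ p, |p.1.2 - p.2.2| ∂γ := by
        rw [integral_add (hdiff.comp_fst γ) (hdiff.comp_snd γ),
          integral_fun_fst (fun p : (ℝ × ℝ) × (ℝ × ℝ) => |p.1.2 - p.2.2|),
          integral_fun_snd (fun p : (ℝ × ℝ) × (ℝ × ℝ) => |p.1.2 - p.2.2|)]
        simp [two_mul]
    _ ≤ _ := by
        refine mul_le_mul_of_nonneg_left (le_trans ?_ hs) zero_le_two
        refine integral_mono hdiff (hint (by fun_prop)) fun p => ?_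
        exact Real.abs_le_sqrt (by nlinarith [sq_nonneg (p.1.1 - p.2.1)])

/-- **`J` is Lipschitz for `d_w` on `X_R`** (Lemma `basic`, part 1): there is a constant `L`
depending only on `R_v` and `R` such that `|J(ν) − J(θ)| ≤ L·d_w(ν, θ)` for all `ν, θ ∈ X_R`;
more precisely `|J₀(ν) − J₀(θ)| ≤ 2·d_w(ν, θ)` and `J₁` is Lipschitz for `d_w`. -/
theorem Jen_lipschitz_for_dw (Rv R : ℝ) (hRv : 0 < Rv) (hR : 0 < R) :
    (∃ L : ℝ, 0 ≤ L ∧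
      ∀ (μ : Measure ℝ) (h : ℝ → ℝ), SigmaFinite μ →
        μ ((Set.Icc (-Rv) (Rv + 1))ᶜ) = 0 →
        (∀ a, 0 ≤ h a) → Integrable h μ → (∫ a, h a ∂μ) = 1 →
        ∀ ν θ : ℝ → Measure ℝ, IsXR μ h R ν → IsXR μ h R θ →
          |Jen μ ν - Jen μ θ| ≤ L * dw μ ν θ) ∧
    (∀ (μ : Measure ℝ) (h : ℝ → ℝ), SigmaFinite μ →
      μ ((Set.Icc (-Rv) (Rv + 1))ᶜ) = 0 →
      (∀ a, 0 ≤ h a) → Integrable h μ → (∫ a, h a ∂μ) = 1 →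
      ∀ ν θ : ℝ → Measure ℝ, IsXR μ h R ν → IsXR μ h R θ →
        |J0 μ ν - J0 μ θ| ≤ 2 * dw μ ν θ) ∧
    (∃ L₁ : ℝ, 0 ≤ L₁ ∧
      ∀ (μ : Measure ℝ) (h : ℝ → ℝ), SigmaFinite μ →
        μ ((Set.Icc (-Rv) (Rv + 1))ᶜ) = 0 →
        (∀ a, 0 ≤ h a) → Integrable h μ → (∫ a, h a ∂μ) = 1 →
        ∀ ν θ : ℝ → Measure ℝ, IsXR μ h R ν → IsXR μ h R θ →
          |J1 μ ν - J1 μ θ| ≤ L₁ * dw μ ν θ) := by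
  have hJ0 := abs_J0_sub_le Rv R
  have hJ1 := abs_J1_sub_le Rv R hRv hR
  refine ⟨⟨1 / 4 * 2 + (Rv + 1 / 2 + R), by positivity, ?_⟩, ?_,
    ⟨Rv + 1 / 2 + R, by positivity, ?_⟩⟩
  · intro μ h _ hμ h0 hi h1 ν θ hν hθ
    have e0 := abs_le.1 (hJ0 μ h hμ h0 hi h1 ν θ hν hθ)
    have e1 := abs_le.1 (hJ1 μ h hμ h0 hi h1 ν θ hν hθ)
    rw [Jen, Jen, abs_le]
    constructor <;> linarith [e0.1, e0.2, e1.1, e1.2]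
  · exact fun μ h _ => hJ0 μ h
  · exact fun μ h _ => hJ1 μ h
end

section
/- The distance d is lower semicontinuous with respect to d_w on X_R: if (ν_n) is a sequence in X_R, ν, θ ∈ X_R, and d_w(ν_n, ν) → 0 as n → ∞, then liminf_{n→∞} d²(ν_n, θ) ≥ d²(ν, θ). -/
open MeasureTheory Filter

/-- The generalized inverse of the cumulative distribution function on `(0, 1)`. -/
noncomputable def quantileFun (ν : Measure ℝ) (u : ℝ) : ℝ :=
  open Classical in
  if u ∈ Set.Ioo (0 : ℝ) 1 then sInf {x | u ≤ ProbabilityTheory.cdf ν x} else 0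

lemma quantileFun_le_iff (ν : Measure ℝ) {u : ℝ} (hu : u ∈ Set.Ioo (0 : ℝ) 1) (s : ℝ) :
    quantileFun ν u ≤ s ↔ u ≤ ProbabilityTheory.cdf ν s := by
  rw [quantileFun, if_pos hu]
  set S := {x | u ≤ ProbabilityTheory.cdf ν x} with hS
  obtain ⟨b, hb⟩ := ((ProbabilityTheory.tendsto_cdf_atBot ν).eventually_lt_const hu.1).exists
  obtain ⟨t, ht⟩ := ((ProbabilityTheory.tendsto_cdf_atTop ν).eventually_const_le hu.2).exists
  have hbdd : BddBelow S := by
    refine ⟨b, fun x hx => ?_⟩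
    by_contra! hxb
    exact absurd (ProbabilityTheory.monotone_cdf ν hxb.le) (not_le.2 (hb.trans_le hx))
  have hne : S.Nonempty := ⟨t, ht⟩
  refine ⟨fun hle => ?_, fun hle => csInf_le hbdd hle⟩
  have hright : Tendsto (ProbabilityTheory.cdf ν) (nhdsWithin s (Set.Ioi s))
      (nhds (ProbabilityTheory.cdf ν s)) :=
    ((ProbabilityTheory.cdf ν).right_continuous s).mono_left
      (nhdsWithin_mono _ Set.Ioi_subset_Ici_self)
  refine ge_of_tendsto hright (eventually_nhdsWithin_of_forall fun y hy => ?_)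
  obtain ⟨z, hz, hzy⟩ := exists_lt_of_csInf_lt hne (hle.trans_lt hy)
  exact le_trans hz (ProbabilityTheory.monotone_cdf ν hzy.le)

lemma measurable_quantileFun (ν : Measure ℝ) : Measurable (quantileFun ν) := by
  refine measurable_of_Iic fun s => ?_
  have : quantileFun ν ⁻¹' Set.Iic s =
      (Set.Ioo 0 1 ∩ Set.Iic (ProbabilityTheory.cdf ν s)) ∪
        ((Set.Ioo (0 : ℝ) 1)ᶜ ∩ {_u | (0 : ℝ) ≤ s}) := by
    ext u
    by_cases hu : u ∈ Set.Ioo (0 : ℝ) 1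
    · simp only [Set.mem_preimage, Set.mem_Iic, quantileFun_le_iff ν hu, Set.mem_union,
        Set.mem_inter_iff, hu, Set.mem_compl_iff, true_and, not_true_eq_false, false_and, or_false]
    · simp [quantileFun, hu]
  rw [this]
  measurability

/-- The comonotone coupling of two probability measures on the line. -/
lemma exists_comonotone_coupling_prob (ν θ : Measure ℝ) [IsProbabilityMeasure ν]
    [IsProbabilityMeasure θ] :
    ∃ γ : Measure (ℝ × ℝ), γ.map Prod.fst = ν ∧ γ.map Prod.snd = θ ∧
      ∀ s t, γ (Set.Iic s ×ˢ Set.Iic t) = min (ν (Set.Iic s)) (θ (Set.Iic t)) := by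
  have hmν := measurable_quantileFun ν
  have hmθ := measurable_quantileFun θ
  have hvol : ∀ c : ℝ, 0 ≤ c → c ≤ 1 →
      volume (Set.Iic c ∩ Set.Ioo (0 : ℝ) 1) = ENNReal.ofReal c := by
    intro c h0 h1
    refine le_antisymm ?_ ?_
    · calc volume (Set.Iic c ∩ Set.Ioo (0 : ℝ) 1) ≤ volume (Set.Ioc 0 c) :=
            measure_mono fun x hx => ⟨hx.2.1, hx.1⟩
        _ = ENNReal.ofReal c := by simp
    · calc ENNReal.ofReal c = volume (Set.Ioo 0 c) := by simp
        _ ≤ volume (Set.Iic c ∩ Set.Ioo (0 : ℝ) 1) :=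
            measure_mono fun x hx => ⟨hx.2.le, hx.1, hx.2.trans_le h1⟩
  have hmarg : ∀ (κ : Measure ℝ) [IsProbabilityMeasure κ],
      (volume.restrict (Set.Ioo (0 : ℝ) 1)).map (quantileFun κ) = κ := by
    intro κ _
    have hm := measurable_quantileFun κ
    refine Measure.ext_of_Iic _ _ fun s => ?_
    rw [Measure.map_apply hm measurableSet_Iic,
      Measure.restrict_apply (hm measurableSet_Iic), ← ProbabilityTheory.ofReal_cdf,
      ← hvol _ (ProbabilityTheory.cdf_nonneg _ _) (ProbabilityTheory.cdf_le_one _ _)]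
    congr 1
    ext u
    simp only [Set.mem_inter_iff, and_congr_left_iff, Set.mem_preimage, Set.mem_Iic]
    exact fun hu => quantileFun_le_iff κ hu s
  refine ⟨(volume.restrict (Set.Ioo (0 : ℝ) 1)).map
    fun u => (quantileFun ν u, quantileFun θ u), ?_, ?_, fun s t => ?_⟩
  · rw [Measure.map_map measurable_fst (hmν.prodMk hmθ)]
    exact hmarg ν
  · rw [Measure.map_map measurable_snd (hmν.prodMk hmθ)]
    exact hmarg θ
  · have hset := (measurableSet_Iic (a := s)).prod (measurableSet_Iic (a := t))
    rw [Measure.map_apply (hmν.prodMk hmθ) hset,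
      Measure.restrict_apply (hmν.prodMk hmθ hset), ← ProbabilityTheory.ofReal_cdf,
      ← ProbabilityTheory.ofReal_cdf, ← ENNReal.ofReal_min,
      ← hvol _ (le_min (ProbabilityTheory.cdf_nonneg _ _) (ProbabilityTheory.cdf_nonneg _ _))
        ((min_le_left _ _).trans (ProbabilityTheory.cdf_le_one _ _))]
    congr 1
    ext u
    simp only [Set.mem_inter_iff, and_congr_left_iff, Set.mem_preimage, Set.mem_Iic,
      Set.mem_prod, le_min_iff]
    exact fun hu => and_congr (quantileFun_le_iff ν hu s) (quantileFun_le_iff θ hu t)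

/-- The comonotone coupling of two finite measures of equal mass on the line. -/
lemma exists_comonotone_coupling (ν θ : Measure ℝ) [IsFiniteMeasure ν]
    (hmass : ν Set.univ = θ Set.univ) :
    ∃ γ : Measure (ℝ × ℝ), γ.map Prod.fst = ν ∧ γ.map Prod.snd = θ ∧
      ∀ s t, γ (Set.Iic s ×ˢ Set.Iic t) = min (ν (Set.Iic s)) (θ (Set.Iic t)) := by
  have : IsFiniteMeasure θ := ⟨hmass ▸ measure_lt_top ν _⟩
  rcases eq_or_ne ν 0 with rfl | hν
  · obtain rfl : θ = 0 := by simpa using hmass.symm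
    exact ⟨0, by simp, by simp, by simp⟩
  have hθ : θ ≠ 0 := by
    rintro rfl
    exact hν (by simpa using hmass)
  have : NeZero ν := ⟨hν⟩
  have : NeZero θ := ⟨hθ⟩
  obtain ⟨γ, h1, h2, h3⟩ := exists_comonotone_coupling_prob
    ((ν Set.univ)⁻¹ • ν) ((θ Set.univ)⁻¹ • θ)
  have h0 : ν Set.univ ≠ 0 := by simpa using hν
  have htop : ν Set.univ ≠ ⊤ := measure_ne_top _ _
  refine ⟨ν Set.univ • γ, ?_, ?_, fun s t => ?_⟩
  · rw [Measure.map_smul, h1, smul_smul, ENNReal.mul_inv_cancel h0 htop, one_smul]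
  · rw [Measure.map_smul, h2, smul_smul, ← hmass, ENNReal.mul_inv_cancel h0 htop, one_smul]
  · rw [Measure.smul_apply, h3, ← hmass]
    simp only [Measure.smul_apply, smul_eq_mul]
    rw [mul_min, ← mul_assoc, ← mul_assoc, ENNReal.mul_inv_cancel h0 htop, one_mul, one_mul]

/-- Lebesgue measure on the square `[-R, R]²`. -/
noncomputable def boxMeasure (R : ℝ) : Measure (ℝ × ℝ) :=
  (volume.restrict (Set.Icc (-R) R)).prod (volume.restrict (Set.Icc (-R) R))

instance (R : ℝ) : IsFiniteMeasure (boxMeasure R) := by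
  unfold boxMeasure; infer_instance

lemma ae_mem_boxMeasure (R : ℝ) :
    ∀ᵐ ω ∂(boxMeasure R), ω.1 ∈ Set.Icc (-R) R ∧ ω.2 ∈ Set.Icc (-R) R := by
  have h : ∀ᵐ s ∂(volume.restrict (Set.Icc (-R) R)), s ∈ Set.Icc (-R) R :=
    ae_restrict_mem measurableSet_Icc
  exact (Measure.quasiMeasurePreserving_fst.ae h).and (Measure.quasiMeasurePreserving_snd.ae h)

/-- The weight with which marginal distribution functions enter the quadratic transport cost. -/
noncomputable def edgeWeight (R s : ℝ) : ℝ := (R - s) / R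

@[fun_prop]
lemma measurable_edgeWeight (R : ℝ) : Measurable (edgeWeight R) := by
  unfold edgeWeight; fun_prop

lemma edgeWeight_mem_Icc {R s : ℝ} (hR : 0 < R) (hs : s ∈ Set.Icc (-R) R) :
    edgeWeight R s ∈ Set.Icc 0 2 := by
  constructor
  · exact div_nonneg (by linarith [hs.2]) hR.le
  · rw [edgeWeight, div_le_iff₀ hR]
    linarith [hs.1]

/-- The integrand of the one-dimensional quadratic transport cost, in terms of the values of the
two marginal distribution functions and the joint one. -/
noncomputable def costDensity (R : ℝ) (ω : ℝ × ℝ) (F G H : ℝ) : ℝ :=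
  edgeWeight R ω.1 * F + edgeWeight R ω.2 * G - 2 * H

lemma abs_costDensity_le {R : ℝ} (hR : 0 < R) {ω : ℝ × ℝ}
    (hω : ω.1 ∈ Set.Icc (-R) R ∧ ω.2 ∈ Set.Icc (-R) R) {F G H c : ℝ}
    (hF : F ∈ Set.Icc 0 c) (hG : G ∈ Set.Icc 0 c) (hH : H ∈ Set.Icc 0 c) :
    |costDensity R ω F G H| ≤ 4 * c := by
  obtain ⟨h1, h2⟩ := edgeWeight_mem_Icc hR hω.1
  obtain ⟨h3, h4⟩ := edgeWeight_mem_Icc hR hω.2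
  have h5 : edgeWeight R ω.1 * F ≤ 2 * c := mul_le_mul h2 hF.2 hF.1 (by norm_num)
  have h6 : edgeWeight R ω.2 * G ≤ 2 * c := mul_le_mul h4 hG.2 hG.1 (by norm_num)
  have h7 := mul_nonneg h1 hF.1
  have h8 := mul_nonneg h3 hG.1
  rw [costDensity, abs_le]
  constructor <;> linarith [hH.1, hH.2, hF.1, hF.2]

/-- The indicator of `{x ≤ s}`. -/
noncomputable def leInd (x s : ℝ) : ℝ := (Set.Iic s).indicator 1 x

lemma leInd_mem_Icc (x s : ℝ) : leInd x s ∈ Set.Icc 0 1 := by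
  unfold leInd
  by_cases h : x ∈ Set.Iic s <;> simp [h]

lemma leInd_eq_indicator_Ici (x : ℝ) : leInd x = (Set.Ici x).indicator 1 := by
  ext s
  simp [leInd, Set.indicator_apply]

lemma measurable_leInd : Measurable fun p : ℝ × ℝ => leInd p.1 p.2 := by
  have : (fun p : ℝ × ℝ => leInd p.1 p.2) = {p : ℝ × ℝ | p.1 ≤ p.2}.indicator 1 := by
    ext p
    simp [leInd, Set.indicator_apply]
  rw [this]
  exact measurable_one.indicator (measurableSet_le measurable_fst measurable_snd)

@[fun_prop]
lemma Measurable.leInd {α : Type*} [MeasurableSpace α] {f g : α → ℝ} (hf : Measurable f)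
    (hg : Measurable g) : Measurable fun a => leInd (f a) (g a) :=
  measurable_leInd.comp (hf.prodMk hg)

lemma integral_mul_leInd {R x : ℝ} (hx : x ∈ Set.Icc (-R) R) (f : ℝ → ℝ) :
    ∫ s in Set.Icc (-R) R, f s * leInd x s = ∫ s in x..R, f s := by
  have : (fun s => f s * leInd x s) = (Set.Ici x).indicator f := by
    ext s
    simp [leInd_eq_indicator_Ici, Set.indicator_apply]
  rw [this, setIntegral_indicator measurableSet_Ici, intervalIntegral.integral_of_le hx.2,
    ← integral_Icc_eq_integral_Ioc]
  congr 2
  ext s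
  simp only [Set.mem_inter_iff, Set.mem_Icc, Set.mem_Ici]
  exact ⟨fun h => ⟨h.2, h.1.2⟩, fun h => ⟨⟨hx.1.trans h.1, h.2⟩, h.1⟩⟩

lemma integrable_boxMeasure_of_bound {R : ℝ} {f : ℝ × ℝ → ℝ} (hf : Measurable f) (c : ℝ)
    (hc : ∀ ω : ℝ × ℝ, ω.1 ∈ Set.Icc (-R) R ∧ ω.2 ∈ Set.Icc (-R) R → |f ω| ≤ c) :
    Integrable f (boxMeasure R) :=
  Integrable.of_bound hf.aestronglyMeasurable c ((ae_mem_boxMeasure R).mono hc)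

/-- The quadratic cost as an integral over pairs of levels. -/
lemma integral_costDensity_leInd {R x y : ℝ} (hR : 0 < R) (hx : x ∈ Set.Icc (-R) R)
    (hy : y ∈ Set.Icc (-R) R) :
    ∫ ω, costDensity R ω (leInd x ω.1) (leInd y ω.2) (leInd x ω.1 * leInd y ω.2)
      ∂(boxMeasure R) = (x - y) ^ 2 := by
  have hw : ∀ z ∈ Set.Icc (-R) R,
      ∫ s in Set.Icc (-R) R, edgeWeight R s * leInd z s = (R - z) ^ 2 / (2 * R) := by
    intro z hz
    rw [integral_mul_leInd hz]
    simp only [edgeWeight]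
    rw [intervalIntegral.integral_div, intervalIntegral.integral_sub (by simp) (by simp)]
    simp
    field_simp
    ring
  have h1 : ∀ z ∈ Set.Icc (-R) R, ∫ s in Set.Icc (-R) R, leInd z s = R - z := by
    intro z hz
    simpa using integral_mul_leInd hz fun _ => 1
  have hvol : ∫ _s in Set.Icc (-R) R, (1 : ℝ) = 2 * R := by
    simp [hR.le]; ring
  have hb : ∀ z s, s ∈ Set.Icc (-R) R → |edgeWeight R s * leInd z s| ≤ 2 := by
    intro z s hs
    obtain ⟨a1, a2⟩ := edgeWeight_mem_Icc hR hs
    obtain ⟨b1, b2⟩ := leInd_mem_Icc z s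
    rw [abs_of_nonneg (mul_nonneg a1 b1)]
    nlinarith
  have i1 : Integrable (fun ω : ℝ × ℝ => edgeWeight R ω.1 * leInd x ω.1) (boxMeasure R) :=
    integrable_boxMeasure_of_bound (by fun_prop) 2 fun ω hω => hb _ _ hω.1
  have i2 : Integrable (fun ω : ℝ × ℝ => edgeWeight R ω.2 * leInd y ω.2) (boxMeasure R) :=
    integrable_boxMeasure_of_bound (by fun_prop) 2 fun ω hω => hb _ _ hω.2
  have i3 : Integrable (fun ω : ℝ × ℝ => 2 * (leInd x ω.1 * leInd y ω.2)) (boxMeasure R) := by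
    refine integrable_boxMeasure_of_bound (by fun_prop) 2 fun ω hω => ?_
    obtain ⟨a1, a2⟩ := leInd_mem_Icc x ω.1
    obtain ⟨b1, b2⟩ := leInd_mem_Icc y ω.2
    rw [abs_of_nonneg (by positivity)]
    nlinarith
  simp only [costDensity]
  rw [integral_sub (i1.fun_add i2) i3, integral_add i1 i2, integral_const_mul]
  have e1 : ∫ ω, edgeWeight R ω.1 * leInd x ω.1 ∂(boxMeasure R) = (R - x) ^ 2 := by
    have := integral_prod_mul (μ := volume.restrict (Set.Icc (-R) R))
      (ν := volume.restrict (Set.Icc (-R) R)) (fun s => edgeWeight R s * leInd x s)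
      (fun _ => (1 : ℝ))
    simp only [mul_one] at this
    rw [boxMeasure, this, hw x hx, hvol]
    field_simp
  have e2 : ∫ ω, edgeWeight R ω.2 * leInd y ω.2 ∂(boxMeasure R) = (R - y) ^ 2 := by
    have := integral_prod_mul (μ := volume.restrict (Set.Icc (-R) R))
      (ν := volume.restrict (Set.Icc (-R) R)) (fun _ => (1 : ℝ))
      (fun s => edgeWeight R s * leInd y s)
    simp only [one_mul] at this
    rw [boxMeasure, this, hw y hy, hvol]
    field_simp
  have e3 : ∫ ω, leInd x ω.1 * leInd y ω.2 ∂(boxMeasure R) = (R - x) * (R - y) := by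
    rw [boxMeasure, integral_prod_mul, h1 x hx, h1 y hy]
  rw [e1, e2, e3]
  ring

lemma integral_leInd (ν : Measure ℝ) (s : ℝ) : ∫ x, leInd x s ∂ν = ν.real (Set.Iic s) :=
  integral_indicator_one measurableSet_Iic

/-- The quadratic cost of a plan supported in `[-R, R]²`, through distribution functions. -/
lemma integral_sq_sub_eq {R : ℝ} (hR : 0 < R) (γ : Measure (ℝ × ℝ)) [IsFiniteMeasure γ]
    (h1 : ∀ᵐ p ∂γ, p.1 ∈ Set.Icc (-R) R) (h2 : ∀ᵐ p ∂γ, p.2 ∈ Set.Icc (-R) R) :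
    Integrable (fun ω => costDensity R ω ((γ.map Prod.fst).real (Set.Iic ω.1))
        ((γ.map Prod.snd).real (Set.Iic ω.2)) (γ.real (Set.Iic ω.1 ×ˢ Set.Iic ω.2)))
        (boxMeasure R) ∧
      ∫ p, (p.1 - p.2) ^ 2 ∂γ =
        ∫ ω, costDensity R ω ((γ.map Prod.fst).real (Set.Iic ω.1))
          ((γ.map Prod.snd).real (Set.Iic ω.2)) (γ.real (Set.Iic ω.1 ×ˢ Set.Iic ω.2))
          ∂(boxMeasure R) := by
  set f : ℝ × ℝ → ℝ × ℝ → ℝ := fun p ω =>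
    costDensity R ω (leInd p.1 ω.1) (leInd p.2 ω.2) (leInd p.1 ω.1 * leInd p.2 ω.2) with hf
  have hint : Integrable (Function.uncurry f) (γ.prod (boxMeasure R)) := by
    refine Integrable.of_bound (Measurable.aestronglyMeasurable ?_) (4 * 1) ?_
    · simp only [hf, Function.uncurry_def, costDensity]
      fun_prop
    · filter_upwards [Measure.quasiMeasurePreserving_snd.ae (ae_mem_boxMeasure R)] with z hz
      have a := leInd_mem_Icc z.1.1 z.2.1
      have b := leInd_mem_Icc z.1.2 z.2.2
      exact abs_costDensity_le hR hz a b
        ⟨mul_nonneg a.1 b.1, mul_le_one₀ a.2 b.1 b.2⟩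
  have hinner : ∀ ω, ∫ p, f p ω ∂γ = costDensity R ω ((γ.map Prod.fst).real (Set.Iic ω.1))
        ((γ.map Prod.snd).real (Set.Iic ω.2)) (γ.real (Set.Iic ω.1 ×ˢ Set.Iic ω.2)) := by
    intro ω
    have hI : ∀ g : ℝ × ℝ → ℝ, Measurable g → (∀ p, g p ∈ Set.Icc 0 1) → Integrable g γ := by
      intro g hg hb
      refine Integrable.of_bound hg.aestronglyMeasurable 1 (ae_of_all _ fun p => ?_)
      rw [Real.norm_of_nonneg (hb p).1]
      exact (hb p).2
    have i1 := hI (fun p => leInd p.1 ω.1) (by fun_prop) fun p => leInd_mem_Icc _ _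
    have i2 := hI (fun p => leInd p.2 ω.2) (by fun_prop) fun p => leInd_mem_Icc _ _
    have e3 : (fun p : ℝ × ℝ => leInd p.1 ω.1 * leInd p.2 ω.2) =
        (Set.Iic ω.1 ×ˢ Set.Iic ω.2).indicator 1 := by
      ext p
      simp only [leInd, Set.indicator_apply, Set.mem_prod, Pi.one_apply]
      split_ifs <;> simp_all
    have i3 : Integrable (fun p : ℝ × ℝ => leInd p.1 ω.1 * leInd p.2 ω.2) γ := by
      rw [e3]
      exact (integrable_const (1 : ℝ)).indicator (measurableSet_Iic.prod measurableSet_Iic)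
    simp only [hf, costDensity]
    rw [integral_sub ((i1.const_mul _).fun_add (i2.const_mul _)) (i3.const_mul _),
      integral_add (i1.const_mul _) (i2.const_mul _), integral_const_mul, integral_const_mul,
      integral_const_mul, e3, integral_indicator_one (measurableSet_Iic.prod measurableSet_Iic),
      ← integral_leInd (γ.map Prod.fst), ← integral_leInd (γ.map Prod.snd),
      integral_map (by fun_prop) (Measurable.aestronglyMeasurable (by fun_prop)),
      integral_map (by fun_prop) (Measurable.aestronglyMeasurable (by fun_prop))]
  refine ⟨?_, ?_⟩
  · have := hint.integral_prod_right
    simpa only [Function.uncurry_apply_pair, hinner] using this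
  · calc ∫ p, (p.1 - p.2) ^ 2 ∂γ = ∫ p, ∫ ω, f p ω ∂(boxMeasure R) ∂γ := by
          refine integral_congr_ae ?_
          filter_upwards [h1, h2] with p hp1 hp2
          exact (integral_costDensity_leInd hR hp1 hp2).symm
      _ = _ := by
          rw [integral_integral_swap hint]
          exact integral_congr_ae (ae_of_all _ hinner)

/-- Explicit formula for the squared Wasserstein distance on an interval. -/
lemma W2sq_eq {R : ℝ} (hR : 0 < R) (ν θ : Measure ℝ) [IsFiniteMeasure ν]
    (hmass : ν Set.univ = θ Set.univ) (hν : ν (Set.Icc (-R) R)ᶜ = 0)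
    (hθ : θ (Set.Icc (-R) R)ᶜ = 0) :
    W2sq ν θ = ∫ ω, costDensity R ω (ν.real (Set.Iic ω.1)) (θ.real (Set.Iic ω.2))
      (min (ν.real (Set.Iic ω.1)) (θ.real (Set.Iic ω.2))) ∂(boxMeasure R) := by
  have hfin : IsFiniteMeasure θ := ⟨hmass ▸ measure_lt_top ν _⟩
  have hplan : ∀ γ : Measure (ℝ × ℝ), γ.map Prod.fst = ν → γ.map Prod.snd = θ →
      IsFiniteMeasure γ ∧ (∀ᵐ p ∂γ, p.1 ∈ Set.Icc (-R) R) ∧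
        ∀ᵐ p ∂γ, p.2 ∈ Set.Icc (-R) R := by
    rintro γ rfl rfl
    refine ⟨⟨?_⟩, ?_, ?_⟩
    · have := measure_lt_top (γ.map Prod.fst) Set.univ
      rwa [Measure.map_apply measurable_fst MeasurableSet.univ] at this
    · rwa [Measure.map_apply measurable_fst measurableSet_Icc.compl] at hν
    · rwa [Measure.map_apply measurable_snd measurableSet_Icc.compl] at hθ
  obtain ⟨γ₀, hγ1, hγ2, hγ3⟩ := exists_comonotone_coupling ν θ hmass
  obtain ⟨hγf, hγa, hγb⟩ := hplan γ₀ hγ1 hγ2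
  obtain ⟨hi₀, he₀⟩ := integral_sq_sub_eq hR γ₀ hγa hγb
  have hmin : ∀ s t, γ₀.real (Set.Iic s ×ˢ Set.Iic t) =
      min (ν.real (Set.Iic s)) (θ.real (Set.Iic t)) := by
    intro s t
    rw [Measure.real, hγ3, ENNReal.toReal_min (measure_ne_top _ _) (measure_ne_top _ _)]
    rfl
  simp only [hγ1, hγ2, hmin] at hi₀ he₀
  refine IsLeast.csInf_eq ⟨⟨γ₀, hγ1, hγ2, he₀.symm⟩, ?_⟩
  rintro _ ⟨γ, h1, h2, rfl⟩
  obtain ⟨hf, ha, hb⟩ := hplan γ h1 h2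
  obtain ⟨hi, he⟩ := integral_sq_sub_eq hR γ ha hb
  rw [he]
  refine integral_mono hi₀ hi fun ω => ?_
  simp only [h1, h2, costDensity]
  have hle : γ.real (Set.Iic ω.1 ×ˢ Set.Iic ω.2) ≤
      min (ν.real (Set.Iic ω.1)) (θ.real (Set.Iic ω.2)) := by
    refine le_min ?_ ?_
    · rw [← h1, map_measureReal_apply measurable_fst measurableSet_Iic]
      exact measureReal_mono fun p hp => hp.1
    · rw [← h2, map_measureReal_apply measurable_snd measurableSet_Iic]
      exact measureReal_mono fun p hp => hp.2
  linarith

open ProbabilityTheory in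
lemma isSFiniteKernel_of_forall_isFiniteMeasure {α β : Type*} [MeasurableSpace α]
    [MeasurableSpace β] (κ : Kernel α β) (hκ : ∀ a, IsFiniteMeasure (κ a)) :
    IsSFiniteKernel κ := by
  classical
  have hm : Measurable fun a => ⌊(κ a Set.univ).toReal⌋₊ :=
    Nat.measurable_floor.comp (κ.measurable_coe MeasurableSet.univ).ennreal_toReal
  have hs : ∀ n, MeasurableSet {a | ⌊(κ a Set.univ).toReal⌋₊ = n} := fun n =>
    hm (measurableSet_singleton n)
  refine ⟨fun n => Kernel.piecewise (hs n) κ 0, fun n => ⟨⟨ENNReal.ofReal (n + 1),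
    ENNReal.ofReal_lt_top, fun a => ?_⟩⟩, ?_⟩
  · rw [Kernel.piecewise_apply]
    split_ifs with h
    · have h : ⌊(κ a Set.univ).toReal⌋₊ = n := h
      rw [← ENNReal.ofReal_toReal (measure_ne_top (κ a) Set.univ), ← h]
      exact ENNReal.ofReal_le_ofReal (Nat.lt_floor_add_one _).le
    · simp
  · ext a s hs'
    rw [Kernel.sum_apply, Measure.sum_apply _ hs', tsum_eq_single ⌊(κ a Set.univ).toReal⌋₊]
    · simp [Kernel.piecewise_apply]
    · intro n hn
      rw [Kernel.piecewise_apply, if_neg fun h => hn h.symm]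
      simp

open ProbabilityTheory in
/-- Every element of `X_R` agrees `μ`-a.e. with a kernel of finite measures on `[-R, R]`. -/
lemma IsXR.exists_kernel {μ : Measure ℝ} [SFinite μ] {h : ℝ → ℝ} {R : ℝ} {ν : ℝ → Measure ℝ}
    (hν : IsXR μ h R ν) :
    ∃ κ : Kernel ℝ ℝ, IsSFiniteKernel κ ∧ (∀ a, IsFiniteMeasure (κ a)) ∧
      (∀ a, κ a (Set.Icc (-R) R)ᶜ = 0) ∧ (∀ᵐ a ∂μ, κ a = ν a) ∧
      (∀ᵐ a ∂μ, κ a Set.univ = ENNReal.ofReal (h a)) ∧ nuOtimes μ ν = μ ⊗ₘ κ := by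
  classical
  have hgood : ∀ᵐ a ∂μ, ν a Set.univ = ENNReal.ofReal (h a) ∧ ν a (Set.Icc (-R) R)ᶜ = 0 :=
    hν.mass.and hν.supp
  obtain ⟨N, hN, hNm, hN0⟩ := exists_measurable_superset_of_null (ae_iff.1 hgood)
  have hnot : ∀ a ∉ N, ν a Set.univ = ENNReal.ofReal (h a) ∧ ν a (Set.Icc (-R) R)ᶜ = 0 := by
    intro a ha
    by_contra hc
    exact ha (hN hc)
  have hNae : ∀ᵐ a ∂μ, a ∉ N := measure_eq_zero_iff_ae_notMem.1 hN0
  set κ : Kernel ℝ ℝ := Kernel.piecewise hNm 0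
    ⟨ν, Measure.measurable_of_measurable_coe ν hν.meas⟩ with hκ
  have hκN : ∀ a ∈ N, κ a = 0 := fun a ha => by rw [hκ, Kernel.piecewise_apply, if_pos ha]; simp
  have hκn : ∀ a ∉ N, κ a = ν a := fun a ha => by
    rw [hκ, Kernel.piecewise_apply, if_neg ha]; rfl
  have hfin : ∀ a, IsFiniteMeasure (κ a) := by
    intro a
    by_cases ha : a ∈ N
    · rw [hκN a ha]; infer_instance
    · rw [hκn a ha]
      exact ⟨by rw [(hnot a ha).1]; exact ENNReal.ofReal_lt_top⟩
  have hsf := isSFiniteKernel_of_forall_isFiniteMeasure κ hfin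
  have hae : ∀ᵐ a ∂μ, κ a = ν a := hNae.mono hκn
  refine ⟨κ, hsf, hfin, fun a => ?_, hae, ?_, ?_⟩
  · by_cases ha : a ∈ N
    · simp [hκN a ha]
    · rw [hκn a ha]; exact (hnot a ha).2
  · filter_upwards [hNae] with a ha
    rw [hκn a ha]; exact (hnot a ha).1
  · have hmeas : Measurable fun a => (κ a).map fun x => (a, x) := by
      refine Measure.measurable_of_measurable_coe _ fun s hs => ?_
      have : ∀ a, (κ a).map (fun x => (a, x)) s = κ a (Prod.mk a ⁻¹' s) := fun a =>
        Measure.map_apply measurable_prodMk_left hs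
      simp only [this]
      exact Kernel.measurable_kernel_prodMk_left hs
    have hcongr : nuOtimes μ ν = μ.bind fun a => (κ a).map fun x => (a, x) := by
      refine Measure.bind_congr_right ?_
      filter_upwards [hae] with a ha
      rw [ha]
    rw [hcongr]
    ext s hs
    rw [Measure.bind_apply hs hmeas.aemeasurable, Measure.compProd_apply hs]
    exact lintegral_congr fun a => Measure.map_apply measurable_prodMk_left hs

/-- Functions with a quadratic modulus of continuity integrate almost equally against measures
that are close in Wasserstein distance. -/
lemma abs_integral_sub_le_W2sqProd {P Q : Measure (ℝ × ℝ)} [IsProbabilityMeasure P]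
    [IsProbabilityMeasure Q] {B : ℝ} (hP : ∀ᵐ p ∂P, |p.1| ≤ B ∧ |p.2| ≤ B)
    (hQ : ∀ᵐ p ∂Q, |p.1| ≤ B ∧ |p.2| ≤ B) {φ : ℝ × ℝ → ℝ} (hφ : Measurable φ) {M : ℝ}
    (hM : ∀ p, |φ p| ≤ M) {ε C : ℝ} (hC : 0 < C)
    (hmod : ∀ p q, |φ p - φ q| ≤ ε + C * ((p.1 - q.1) ^ 2 + (p.2 - q.2) ^ 2)) :
    |∫ p, φ p ∂P - ∫ p, φ p ∂Q| ≤ ε + C * W2sqProd P Q := by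
  have key : ∀ r ∈ { r : ℝ | ∃ γ : Measure ((ℝ × ℝ) × (ℝ × ℝ)),
      γ.map Prod.fst = P ∧ γ.map Prod.snd = Q ∧
        r = ∫ p, (fun p q : ℝ × ℝ => (p.1 - q.1) ^ 2 + (p.2 - q.2) ^ 2) p.1 p.2 ∂γ },
      (|∫ p, φ p ∂P - ∫ p, φ p ∂Q| - ε) / C ≤ r := by
    rintro _ ⟨γ, h1, h2, rfl⟩
    have hγ : IsProbabilityMeasure γ := ⟨by
      have := measure_univ (μ := P)
      rwa [← h1, Measure.map_apply measurable_fst MeasurableSet.univ] at this⟩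
    rw [← h1] at hP
    rw [← h2] at hQ
    have hP' := ae_of_ae_map measurable_fst.aemeasurable hP
    have hQ' := ae_of_ae_map measurable_snd.aemeasurable hQ
    have hcost : Integrable (fun p : (ℝ × ℝ) × (ℝ × ℝ) =>
        (p.1.1 - p.2.1) ^ 2 + (p.1.2 - p.2.2) ^ 2) γ := by
      refine Integrable.of_bound (Measurable.aestronglyMeasurable (by fun_prop)) (8 * B ^ 2) ?_
      filter_upwards [hP', hQ'] with p hp hq
      rw [Real.norm_of_nonneg (by positivity)]
      obtain ⟨a1, a2⟩ := hp
      obtain ⟨a3, a4⟩ := hq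
      rw [abs_le] at a1 a2 a3 a4
      have hsq : ∀ x y : ℝ, -B ≤ x ∧ x ≤ B → -B ≤ y ∧ y ≤ B → (x - y) ^ 2 ≤ (2 * B) ^ 2 :=
        fun x y hx hy => sq_le_sq' (by linarith) (by linarith)
      nlinarith [hsq _ _ a1 a3, hsq _ _ a2 a4]
    have hint : ∀ g : (ℝ × ℝ) × (ℝ × ℝ) → ℝ × ℝ, Measurable g →
        Integrable (fun p => φ (g p)) γ := fun g hg =>
      Integrable.of_bound (hφ.comp hg).aestronglyMeasurable M (ae_of_all _ fun p => hM _)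
    rw [div_le_iff₀ hC, sub_le_iff_le_add']
    calc |∫ p, φ p ∂P - ∫ p, φ p ∂Q| = |∫ p, (φ p.1 - φ p.2) ∂γ| := by
          rw [integral_sub (hint _ measurable_fst) (hint _ measurable_snd), ← h1, ← h2,
            integral_map measurable_fst.aemeasurable hφ.aestronglyMeasurable,
            integral_map measurable_snd.aemeasurable hφ.aestronglyMeasurable]
      _ ≤ ∫ p, |φ p.1 - φ p.2| ∂γ := abs_integral_le_integral_abs
      _ ≤ ∫ p : (ℝ × ℝ) × (ℝ × ℝ),
            (ε + C * ((p.1.1 - p.2.1) ^ 2 + (p.1.2 - p.2.2) ^ 2)) ∂γ :=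
          integral_mono ((hint _ measurable_fst).sub (hint _ measurable_snd)).abs
            ((integrable_const _).add (hcost.const_mul _)) fun p => hmod _ _
      _ = _ := by
          rw [integral_add (integrable_const _) (hcost.const_mul _), integral_const_mul]
          simp [mul_comm]
  have hne : { r : ℝ | ∃ γ : Measure ((ℝ × ℝ) × (ℝ × ℝ)),
      γ.map Prod.fst = P ∧ γ.map Prod.snd = Q ∧
        r = ∫ p, (fun p q : ℝ × ℝ => (p.1 - q.1) ^ 2 + (p.2 - q.2) ^ 2) p.1 p.2 ∂γ }.Nonempty :=
    ⟨_, P.prod Q, by simp, by simp, rfl⟩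
  have := le_csInf hne key
  rw [div_le_iff₀ hC, sub_le_iff_le_add'] at this
  rwa [mul_comm] at this

lemma W2sqProd_nonneg (P Q : Measure (ℝ × ℝ)) : 0 ≤ W2sqProd P Q := by
  refine Real.sInf_nonneg ?_
  rintro _ ⟨γ, -, -, rfl⟩
  exact integral_nonneg fun p => by positivity

/-- A bounded uniformly continuous function has, up to `ε`, a quadratic modulus of continuity. -/
lemma exists_quadratic_modulus {E : Type*} [PseudoMetricSpace E] {f : E → ℝ}
    (hf : UniformContinuous f) {M : ℝ} (hM : ∀ x, |f x| ≤ M) {ε : ℝ} (hε : 0 < ε) :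
    ∃ C, 0 ≤ C ∧ ∀ x y, |f x - f y| ≤ ε + C * dist x y ^ 2 := by
  obtain ⟨δ, hδ, h⟩ := Metric.uniformContinuous_iff.1 hf ε hε
  refine ⟨2 * |M| / δ ^ 2, by positivity, fun x y => ?_⟩
  rcases lt_or_ge (dist x y) δ with hlt | hge
  · have h1 := (h hlt).le
    rw [Real.dist_eq] at h1
    have : 0 ≤ 2 * |M| / δ ^ 2 * dist x y ^ 2 := by positivity
    linarith
  · have h1 : |f x - f y| ≤ 2 * |M| := by
      have := abs_sub (f x) (f y)
      linarith [hM x, hM y, le_abs_self M]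
    have h2 : 2 * |M| ≤ 2 * |M| / δ ^ 2 * dist x y ^ 2 := by
      rw [div_mul_eq_mul_div, le_div_iff₀ (by positivity)]
      gcongr
    linarith

lemma integral_abs_leInd_sub_le {R : ℝ} (x y : ℝ) :
    ∫ s in Set.Icc (-R) R, |leInd x s - leInd y s| ≤ |x - y| := by
  wlog hxy : x ≤ y generalizing x y
  · have := this y x (le_of_not_ge hxy)
    simpa only [abs_sub_comm] using this
  have : (fun s => |leInd x s - leInd y s|) = (Set.Ico x y).indicator 1 := by
    ext s
    simp only [leInd, Set.indicator_apply, Set.mem_Iic, Set.mem_Ico, Pi.one_apply]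
    split_ifs <;> (try simp) <;> grind
  rw [this, integral_indicator_one measurableSet_Ico, abs_sub_comm, abs_of_nonneg (by linarith)]
  calc (volume.restrict (Set.Icc (-R) R)).real (Set.Ico x y) ≤ volume.real (Set.Ico x y) :=
        ENNReal.toReal_mono (by simp) (Measure.restrict_apply_le _ _)
    _ = y - x := by simp [hxy]

/-- The integral of `β (a, ω)` over the levels `ω` whose first coordinate is at least `x`. -/
noncomputable def tailIntegral (R : ℝ) (β : ℝ × ℝ × ℝ → ℝ) (p : ℝ × ℝ) : ℝ :=
  ∫ ω, β (p.1, ω) * leInd p.2 ω.1 ∂(boxMeasure R)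

lemma measurable_tailIntegral (R : ℝ) {β : ℝ × ℝ × ℝ → ℝ} (hβ : Measurable β) :
    Measurable (tailIntegral R β) := by
  have : Measurable fun z : (ℝ × ℝ) × ℝ × ℝ => β (z.1.1, z.2) * leInd z.1.2 z.2.1 := by
    fun_prop
  exact this.stronglyMeasurable.integral_prod_right.measurable

lemma abs_mul_leInd_le {M b : ℝ} (hb : |b| ≤ M) (x s : ℝ) : |b * leInd x s| ≤ M := by
  obtain ⟨h0, h1⟩ := leInd_mem_Icc x s
  rw [abs_mul, abs_of_nonneg h0]
  exact (mul_le_of_le_one_right (abs_nonneg b) h1).trans hb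

lemma abs_tailIntegral_le (R : ℝ) {β : ℝ × ℝ × ℝ → ℝ} {M : ℝ} (hM : ∀ z, |β z| ≤ M)
    (p : ℝ × ℝ) : |tailIntegral R β p| ≤ M * (boxMeasure R).real Set.univ := by
  rw [← Real.norm_eq_abs]
  exact norm_integral_le_of_norm_le_const (ae_of_all _ fun ω => abs_mul_leInd_le (hM _) _ _)

lemma exists_quadratic_modulus_tailIntegral {R : ℝ} (hR : 0 < R) {β : ℝ × ℝ × ℝ → ℝ}
    (hβ : UniformContinuous β) {M : ℝ} (hM : ∀ z, |β z| ≤ M) {ε : ℝ} (hε : 0 < ε) :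
    ∃ C, 0 < C ∧ ∀ p q : ℝ × ℝ, |tailIntegral R β p - tailIntegral R β q| ≤
      ε + C * ((p.1 - q.1) ^ 2 + (p.2 - q.2) ^ 2) := by
  have hM0 : 0 ≤ M := (abs_nonneg _).trans (hM 0)
  set m := (boxMeasure R).real Set.univ with hm
  have hm0 : 0 ≤ m := measureReal_nonneg
  obtain ⟨C, hC0, hC⟩ := exists_quadratic_modulus hβ hM
    (show 0 < ε / (2 * (m + 1)) by positivity)
  set K := 2 * R * M with hK
  have hK0 : 0 ≤ K := by positivity
  refine ⟨C * m + K ^ 2 / (2 * ε) + 1, by positivity, fun p q => ?_⟩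
  have hmeas : ∀ r : ℝ × ℝ, Measurable fun ω : ℝ × ℝ => β (r.1, ω) * leInd r.2 ω.1 := by
    intro r
    have := hβ.continuous.measurable
    fun_prop
  have hint : ∀ r : ℝ × ℝ, Integrable (fun ω : ℝ × ℝ => β (r.1, ω) * leInd r.2 ω.1)
      (boxMeasure R) := fun r =>
    Integrable.of_bound (hmeas r).aestronglyMeasurable M
      (ae_of_all _ fun ω => abs_mul_leInd_le (hM _) _ _)
  have hdiff : Integrable (fun ω : ℝ × ℝ => |leInd p.2 ω.1 - leInd q.2 ω.1|)
      (boxMeasure R) := by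
    refine Integrable.of_bound (Measurable.aestronglyMeasurable ?_) 1 (ae_of_all _ fun ω => ?_)
    · exact ((by fun_prop : Measurable fun ω : ℝ × ℝ =>
        leInd p.2 ω.1 - leInd q.2 ω.1)).abs
    · obtain ⟨a0, a1⟩ := leInd_mem_Icc p.2 ω.1
      obtain ⟨b0, b1⟩ := leInd_mem_Icc q.2 ω.1
      rw [Real.norm_eq_abs, abs_abs, abs_le]
      constructor <;> linarith
  have hpt : ∀ ω : ℝ × ℝ, |β (p.1, ω) * leInd p.2 ω.1 - β (q.1, ω) * leInd q.2 ω.1| ≤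
      (ε / (2 * (m + 1)) + C * (p.1 - q.1) ^ 2) + M * |leInd p.2 ω.1 - leInd q.2 ω.1| := by
    intro ω
    have h1 := hC (p.1, ω) (q.1, ω)
    have hd : dist (p.1, ω) (q.1, ω) ^ 2 = (p.1 - q.1) ^ 2 := by
      rw [dist_prod_same_right, Real.dist_eq, sq_abs]
    rw [hd] at h1
    have h2 : β (p.1, ω) * leInd p.2 ω.1 - β (q.1, ω) * leInd q.2 ω.1 =
        (β (p.1, ω) - β (q.1, ω)) * leInd p.2 ω.1 +
          β (q.1, ω) * (leInd p.2 ω.1 - leInd q.2 ω.1) := by ring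
    rw [h2]
    refine (abs_add_le _ _).trans (add_le_add (abs_mul_leInd_le h1 _ _) ?_)
    rw [abs_mul]
    exact mul_le_mul_of_nonneg_right (hM _) (abs_nonneg _)
  have hbox : ∫ ω, |leInd p.2 ω.1 - leInd q.2 ω.1| ∂(boxMeasure R) ≤ 2 * R * |p.2 - q.2| := by
    have := integral_prod_mul (μ := volume.restrict (Set.Icc (-R) R))
      (ν := volume.restrict (Set.Icc (-R) R)) (fun s => |leInd p.2 s - leInd q.2 s|)
      (fun _ => (1 : ℝ))
    simp only [mul_one] at this
    have hvol : ∫ _s in Set.Icc (-R) R, (1 : ℝ) = 2 * R := by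
      simp [hR.le]; ring
    rw [boxMeasure, this, hvol, mul_comm]
    gcongr
    exact integral_abs_leInd_sub_le _ _
  have hmain : |tailIntegral R β p - tailIntegral R β q| ≤
      m * (ε / (2 * (m + 1)) + C * (p.1 - q.1) ^ 2) + K * |p.2 - q.2| := by
    calc |tailIntegral R β p - tailIntegral R β q|
        = |∫ ω, (β (p.1, ω) * leInd p.2 ω.1 - β (q.1, ω) * leInd q.2 ω.1) ∂(boxMeasure R)| := by
          rw [integral_sub (hint p) (hint q)]; rfl
      _ ≤ ∫ ω, |β (p.1, ω) * leInd p.2 ω.1 - β (q.1, ω) * leInd q.2 ω.1| ∂(boxMeasure R) :=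
          abs_integral_le_integral_abs
      _ ≤ ∫ ω, ((ε / (2 * (m + 1)) + C * (p.1 - q.1) ^ 2) +
            M * |leInd p.2 ω.1 - leInd q.2 ω.1|) ∂(boxMeasure R) :=
          integral_mono ((hint p).sub (hint q)).abs
            ((integrable_const _).add (hdiff.const_mul _)) hpt
      _ = m * (ε / (2 * (m + 1)) + C * (p.1 - q.1) ^ 2) +
            M * ∫ ω, |leInd p.2 ω.1 - leInd q.2 ω.1| ∂(boxMeasure R) := by
          rw [integral_add (integrable_const _) (hdiff.const_mul _), integral_const_mul,
            integral_const, smul_eq_mul]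
      _ ≤ _ := by
          have := mul_le_mul_of_nonneg_left hbox hM0
          rw [hK]
          linarith
  have h1 : m * (ε / (2 * (m + 1))) ≤ ε / 2 := by
    rw [mul_div_assoc', div_le_div_iff₀ (by positivity) (by positivity)]
    nlinarith
  have h2 : K * |p.2 - q.2| ≤ ε / 2 + K ^ 2 / (2 * ε) * (p.2 - q.2) ^ 2 := by
    have : ε / 2 + K ^ 2 / (2 * ε) * (p.2 - q.2) ^ 2 - K * |p.2 - q.2| =
        (ε - K * |p.2 - q.2|) ^ 2 / (2 * ε) := by
      rw [← sq_abs (p.2 - q.2)]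
      field_simp
      ring
    have h3 : 0 ≤ (ε - K * |p.2 - q.2|) ^ 2 / (2 * ε) := by positivity
    linarith
  have h4 : 0 ≤ (C * m + 1) * (p.2 - q.2) ^ 2 := by positivity
  have h5 : 0 ≤ (K ^ 2 / (2 * ε) + 1) * (p.1 - q.1) ^ 2 := by positivity
  nlinarith

/-- The distribution functions of a kernel, as a function of label and level. -/
noncomputable def kernelCdf (κ : ProbabilityTheory.Kernel ℝ ℝ) (a s : ℝ) : ℝ :=
  (κ a).real (Set.Iic s)

lemma measurable_kernelCdf (κ : ProbabilityTheory.Kernel ℝ ℝ)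
    [ProbabilityTheory.IsSFiniteKernel κ] :
    Measurable fun p : ℝ × ℝ => kernelCdf κ p.1 p.2 := by
  have h := ProbabilityTheory.Kernel.measurable_kernel_prodMk_left
    (κ := κ.comap (Prod.fst : ℝ × ℝ → ℝ) measurable_fst)
    (t := {q : (ℝ × ℝ) × ℝ | q.2 ≤ q.1.2})
    (measurableSet_le measurable_snd measurable_fst.snd)
  exact h.ennreal_toReal

@[fun_prop]
lemma Measurable.kernelCdf {α : Type*} [MeasurableSpace α] {f g : α → ℝ}
    {κ : ProbabilityTheory.Kernel ℝ ℝ} [ProbabilityTheory.IsSFiniteKernel κ]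
    (hf : Measurable f) (hg : Measurable g) : Measurable fun x => kernelCdf κ (f x) (g x) :=
  (measurable_kernelCdf κ).comp (hf.prodMk hg)

lemma kernelCdf_mem_Icc {κ : ProbabilityTheory.Kernel ℝ ℝ} {h : ℝ → ℝ} {a : ℝ} (h0 : 0 ≤ h a)
    (ha : κ a Set.univ = ENNReal.ofReal (h a)) (s : ℝ) : kernelCdf κ a s ∈ Set.Icc 0 (h a) := by
  refine ⟨measureReal_nonneg, ?_⟩
  rw [← ENNReal.toReal_ofReal h0, ← ha]
  exact ENNReal.toReal_mono (by rw [ha]; exact ENNReal.ofReal_ne_top) (measure_mono (Set.subset_univ _))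

lemma integrable_prod_boxMeasure {μ : Measure ℝ} [SFinite μ] {R : ℝ} {h : ℝ → ℝ}
    (hint : Integrable h μ) : Integrable (fun z : ℝ × ℝ × ℝ => h z.1) (μ.prod (boxMeasure R)) := by
  simpa using hint.mul_prod (integrable_const (1 : ℝ) (μ := boxMeasure R))

lemma ae_prod_boxMeasure {μ : Measure ℝ} [SFinite μ] {R : ℝ} {p : ℝ → Prop}
    (hp : ∀ᵐ a ∂μ, p a) : ∀ᵐ z ∂(μ.prod (boxMeasure R)), p z.1 :=
  Measure.quasiMeasurePreserving_fst.ae hp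

open ProbabilityTheory in
lemma integral_tailIntegral {μ : Measure ℝ} [SFinite μ] {R : ℝ} {h : ℝ → ℝ}
    (hh0 : ∀ a, 0 ≤ h a) (hint : Integrable h μ) {κ : Kernel ℝ ℝ} [IsSFiniteKernel κ]
    [∀ a, IsFiniteMeasure (κ a)] [IsFiniteMeasure (μ ⊗ₘ κ)]
    (hκ : ∀ᵐ a ∂μ, κ a Set.univ = ENNReal.ofReal (h a)) {β : ℝ × ℝ × ℝ → ℝ} (hβ : Measurable β)
    {M : ℝ} (hM : ∀ z, |β z| ≤ M) :
    Integrable (fun z => β z * kernelCdf κ z.1 z.2.1) (μ.prod (boxMeasure R)) ∧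
      ∫ p, tailIntegral R β p ∂(μ ⊗ₘ κ) =
        ∫ z, β z * kernelCdf κ z.1 z.2.1 ∂(μ.prod (boxMeasure R)) := by
  have hI : Integrable (fun z => β z * kernelCdf κ z.1 z.2.1) (μ.prod (boxMeasure R)) := by
    refine ((integrable_prod_boxMeasure (R := R) hint).const_mul M).mono'
      (Measurable.aestronglyMeasurable (by fun_prop)) ?_
    filter_upwards [ae_prod_boxMeasure hκ] with z hz
    obtain ⟨a0, a1⟩ := kernelCdf_mem_Icc (hh0 _) hz z.2.1
    rw [Real.norm_eq_abs, abs_mul, abs_of_nonneg a0]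
    exact mul_le_mul (hM z) a1 a0 ((abs_nonneg _).trans (hM z))
  refine ⟨hI, ?_⟩
  have hT : Integrable (tailIntegral R β) (μ ⊗ₘ κ) :=
    Integrable.of_bound (measurable_tailIntegral R hβ).aestronglyMeasurable _
      (ae_of_all _ fun p => abs_tailIntegral_le R hM p)
  rw [Measure.integral_compProd hT, integral_prod _ hI]
  refine integral_congr_ae (ae_of_all _ fun a => ?_)
  simp only [tailIntegral]
  rw [integral_integral_swap]
  · refine integral_congr_ae (ae_of_all _ fun ω => ?_)
    simp only [integral_const_mul, integral_leInd]
    rfl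
  · refine Integrable.of_bound (Measurable.aestronglyMeasurable ?_) M
      (ae_of_all _ fun z => abs_mul_leInd_le (hM _) _ _)
    simp only [Function.uncurry_def]
    fun_prop

open ProbabilityTheory in
lemma isProbabilityMeasure_compProd {μ : Measure ℝ} [SFinite μ] {h : ℝ → ℝ}
    (hh0 : ∀ a, 0 ≤ h a) (hint : Integrable h μ) (hh1 : (∫ a, h a ∂μ) = 1) {κ : Kernel ℝ ℝ}
    [IsSFiniteKernel κ] (hκ : ∀ᵐ a ∂μ, κ a Set.univ = ENNReal.ofReal (h a)) :
    IsProbabilityMeasure (μ ⊗ₘ κ) := by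
  refine ⟨?_⟩
  rw [Measure.compProd_apply MeasurableSet.univ]
  simp only [Set.preimage_univ]
  rw [lintegral_congr_ae hκ, ← ofReal_integral_eq_lintegral_ofReal hint (ae_of_all _ hh0), hh1,
    ENNReal.ofReal_one]

open ProbabilityTheory in
lemma ae_bounded_compProd {μ : Measure ℝ} [SFinite μ] {B R : ℝ} (hB : ∀ᵐ a ∂μ, |a| ≤ B)
    (hRB : R ≤ B) {κ : Kernel ℝ ℝ} [IsSFiniteKernel κ]
    (hsupp : ∀ a, κ a (Set.Icc (-R) R)ᶜ = 0) :
    ∀ᵐ p ∂(μ ⊗ₘ κ), |p.1| ≤ B ∧ |p.2| ≤ B := by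
  refine Measure.ae_compProd_of_ae_ae ?_ ?_
  · exact (measurableSet_le measurable_fst.abs measurable_const).inter
      (measurableSet_le measurable_snd.abs measurable_const)
  · filter_upwards [hB] with a ha
    have hx : ∀ᵐ x ∂(κ a), x ∈ Set.Icc (-R) R := hsupp a
    filter_upwards [hx] with x hx
    exact ⟨ha, (abs_le.2 hx).trans hRB⟩

open ProbabilityTheory in
/-- Wasserstein convergence implies weak convergence of the distribution functions against
bounded measurable functions, since the label marginal is fixed. -/
lemma tendsto_integral_mul_kernelCdf {μ : Measure ℝ} [SFinite μ] {R B : ℝ} (hR : 0 < R)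
    {h : ℝ → ℝ} (hh0 : ∀ a, 0 ≤ h a) (hint : Integrable h μ) {κn : ℕ → Kernel ℝ ℝ}
    {κ : Kernel ℝ ℝ} [∀ n, IsSFiniteKernel (κn n)] [IsSFiniteKernel κ]
    [∀ n a, IsFiniteMeasure (κn n a)] [∀ a, IsFiniteMeasure (κ a)]
    [∀ n, IsProbabilityMeasure (μ ⊗ₘ κn n)] [IsProbabilityMeasure (μ ⊗ₘ κ)]
    (hκn : ∀ n, ∀ᵐ a ∂μ, κn n a Set.univ = ENNReal.ofReal (h a))
    (hκ : ∀ᵐ a ∂μ, κ a Set.univ = ENNReal.ofReal (h a))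
    (hBn : ∀ n, ∀ᵐ p ∂(μ ⊗ₘ κn n), |p.1| ≤ B ∧ |p.2| ≤ B)
    (hB : ∀ᵐ p ∂(μ ⊗ₘ κ), |p.1| ≤ B ∧ |p.2| ≤ B)
    (hconv : Tendsto (fun n => W2sqProd (μ ⊗ₘ κn n) (μ ⊗ₘ κ)) atTop (nhds 0))
    {β : ℝ × ℝ × ℝ → ℝ} (hβ : Measurable β) {M : ℝ}
    (hM : ∀ᵐ z ∂(μ.prod (boxMeasure R)), |β z| ≤ M) :
    Tendsto (fun n => ∫ z, β z * kernelCdf (κn n) z.1 z.2.1 ∂(μ.prod (boxMeasure R))) atTop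
      (nhds (∫ z, β z * kernelCdf κ z.1 z.2.1 ∂(μ.prod (boxMeasure R)))) := by
  set π := μ.prod (boxMeasure R) with hπ
  have hhint : Integrable (fun z : ℝ × ℝ × ℝ => h z.1) π := integrable_prod_boxMeasure hint
  set ρ := π.withDensity fun z => ENNReal.ofReal (h z.1) with hρ
  have hρfin : IsFiniteMeasure ρ := isFiniteMeasure_withDensity_ofReal hhint.2
  have hae : AEMeasurable (fun z : ℝ × ℝ × ℝ => ENNReal.ofReal (h z.1)) π :=
    hhint.1.aemeasurable.ennreal_ofReal
  have hβρ : Integrable β ρ := Integrable.of_bound hβ.aestronglyMeasurable M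
    ((withDensity_absolutelyContinuous π _).ae_le hM)
  have hlt : ∀ᵐ z ∂π, ENNReal.ofReal (h z.1) < ⊤ := ae_of_all _ fun z => ENNReal.ofReal_lt_top
  rw [Metric.tendsto_atTop]
  intro ε hε
  obtain ⟨g, hgc, hgβ, hgcont, hgint⟩ :=
    hβρ.exists_hasCompactSupport_integral_sub_le (show 0 < ε / 4 by positivity)
  obtain ⟨L, hL⟩ := hgc.exists_bound_of_continuous hgcont
  have hgm := hgcont.measurable
  have hdiff : Integrable (fun z => h z.1 * ‖β z - g z‖) π := by
    have := (integrable_withDensity_iff_integrable_smul₀' hae hlt).1 (hβρ.sub hgint).norm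
    simpa only [ENNReal.toReal_ofReal (hh0 _), smul_eq_mul, Pi.sub_apply] using this
  have hdiffle : ∫ z, h z.1 * ‖β z - g z‖ ∂π ≤ ε / 4 := by
    rw [hρ, integral_withDensity_eq_integral_toReal_smul₀ hae hlt] at hgβ
    simpa only [ENNReal.toReal_ofReal (hh0 _), smul_eq_mul] using hgβ
  have happrox : ∀ (η : Kernel ℝ ℝ) [IsSFiniteKernel η],
      (∀ᵐ a ∂μ, η a Set.univ = ENNReal.ofReal (h a)) →
      Integrable (fun z => g z * kernelCdf η z.1 z.2.1) π →
      |∫ z, β z * kernelCdf η z.1 z.2.1 ∂π - ∫ z, g z * kernelCdf η z.1 z.2.1 ∂π| ≤ ε / 4 := by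
    intro η _ hη hgη
    have hle : ∀ᵐ z ∂π, ‖(β z - g z) * kernelCdf η z.1 z.2.1‖ ≤ h z.1 * ‖β z - g z‖ := by
      filter_upwards [ae_prod_boxMeasure hη] with z hz
      obtain ⟨a0, a1⟩ := kernelCdf_mem_Icc (hh0 _) hz z.2.1
      rw [norm_mul, Real.norm_of_nonneg a0, mul_comm]
      gcongr
    have hd : Integrable (fun z => (β z - g z) * kernelCdf η z.1 z.2.1) π :=
      hdiff.mono' (Measurable.aestronglyMeasurable (by fun_prop)) hle
    have hβη : Integrable (fun z => β z * kernelCdf η z.1 z.2.1) π := by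
      refine (hd.add hgη).congr (ae_of_all _ fun z => ?_)
      simp only [Pi.add_apply]
      ring
    rw [← integral_sub hβη hgη]
    simp only [← sub_mul]
    exact (norm_integral_le_of_norm_le hdiff hle).trans hdiffle
  have hgu := hgc.uniformContinuous_of_continuous hgcont
  obtain ⟨C, hC0, hC⟩ := exists_quadratic_modulus_tailIntegral hR hgu hL
    (show 0 < ε / 8 by positivity)
  obtain ⟨N, hN⟩ := eventually_atTop.1
    (hconv.eventually_lt_const (show 0 < ε / (8 * C) by positivity))
  refine ⟨N, fun n hn => ?_⟩
  obtain ⟨i1, e1⟩ := integral_tailIntegral (R := R) hh0 hint (hκn n) hgm hL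
  obtain ⟨i2, e2⟩ := integral_tailIntegral (R := R) hh0 hint hκ hgm hL
  have hmid := abs_integral_sub_le_W2sqProd (hBn n) hB (measurable_tailIntegral R hgm)
    (abs_tailIntegral_le R hL) hC0 hC
  rw [e1, e2] at hmid
  have hW : C * W2sqProd (μ ⊗ₘ κn n) (μ ⊗ₘ κ) < ε / 8 := by
    have := mul_lt_mul_of_pos_left (hN n hn) hC0
    have e : C * (ε / (8 * C)) = ε / 8 := by field_simp
    linarith
  have a1 := happrox (κn n) (hκn n) i1
  have a2 := happrox κ hκ i2
  rw [Real.dist_eq, abs_lt]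
  rw [abs_le] at a1 a2 hmid
  constructor <;> linarith [a1.1, a1.2, a2.1, a2.2, hmid.1, hmid.2]

open ProbabilityTheory in
/-- The squared distance `d²` through distribution functions. -/
lemma dsq_eq_integral_costDensity {μ : Measure ℝ} [SFinite μ] {R : ℝ} (hR : 0 < R) {h : ℝ → ℝ}
    (hh0 : ∀ a, 0 ≤ h a) (hint : Integrable h μ) {ν θ : ℝ → Measure ℝ} {κ η : Kernel ℝ ℝ}
    [IsSFiniteKernel κ] [IsSFiniteKernel η] [∀ a, IsFiniteMeasure (κ a)]
    (hκν : ∀ᵐ a ∂μ, κ a = ν a) (hηθ : ∀ᵐ a ∂μ, η a = θ a)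
    (hκ : ∀ᵐ a ∂μ, κ a Set.univ = ENNReal.ofReal (h a))
    (hη : ∀ᵐ a ∂μ, η a Set.univ = ENNReal.ofReal (h a))
    (hκs : ∀ a, κ a (Set.Icc (-R) R)ᶜ = 0) (hηs : ∀ a, η a (Set.Icc (-R) R)ᶜ = 0) :
    Integrable (fun z : ℝ × ℝ × ℝ => costDensity R z.2 (kernelCdf κ z.1 z.2.1)
        (kernelCdf η z.1 z.2.2) (min (kernelCdf κ z.1 z.2.1) (kernelCdf η z.1 z.2.2)))
        (μ.prod (boxMeasure R)) ∧
      dsq μ ν θ = ∫ z : ℝ × ℝ × ℝ, costDensity R z.2 (kernelCdf κ z.1 z.2.1)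
        (kernelCdf η z.1 z.2.2) (min (kernelCdf κ z.1 z.2.1) (kernelCdf η z.1 z.2.2))
        ∂(μ.prod (boxMeasure R)) ∧
      dsq μ ν θ ≤ ∫ z : ℝ × ℝ × ℝ, 4 * h z.1 ∂(μ.prod (boxMeasure R)) := by
  have hbound : ∀ᵐ z ∂(μ.prod (boxMeasure R)), ‖costDensity R z.2 (kernelCdf κ z.1 z.2.1)
      (kernelCdf η z.1 z.2.2) (min (kernelCdf κ z.1 z.2.1) (kernelCdf η z.1 z.2.2))‖ ≤
        4 * h z.1 := by
    filter_upwards [ae_prod_boxMeasure hκ, ae_prod_boxMeasure hη,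
      Measure.quasiMeasurePreserving_snd.ae (ae_mem_boxMeasure R)] with z h1 h2 h3
    have a := kernelCdf_mem_Icc (hh0 _) h1 z.2.1
    have b := kernelCdf_mem_Icc (hh0 _) h2 z.2.2
    exact abs_costDensity_le hR h3 a b ⟨le_min a.1 b.1, (min_le_left _ _).trans a.2⟩
  have hdom := (integrable_prod_boxMeasure (R := R) hint).const_mul 4
  have hI : Integrable (fun z : ℝ × ℝ × ℝ => costDensity R z.2 (kernelCdf κ z.1 z.2.1)
        (kernelCdf η z.1 z.2.2) (min (kernelCdf κ z.1 z.2.1) (kernelCdf η z.1 z.2.2)))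
        (μ.prod (boxMeasure R)) := by
    refine hdom.mono' (Measurable.aestronglyMeasurable ?_) hbound
    unfold costDensity
    fun_prop
  have heq : dsq μ ν θ = ∫ z : ℝ × ℝ × ℝ, costDensity R z.2 (kernelCdf κ z.1 z.2.1)
        (kernelCdf η z.1 z.2.2) (min (kernelCdf κ z.1 z.2.1) (kernelCdf η z.1 z.2.2))
        ∂(μ.prod (boxMeasure R)) := by
    rw [integral_prod _ hI]
    refine integral_congr_ae ?_
    filter_upwards [hκν, hηθ, hκ, hη] with a h1 h2 h3 h4
    rw [← h1, ← h2]
    exact W2sq_eq hR (κ a) (η a) (h3.trans h4.symm) (hκs a) (hηs a)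
  refine ⟨hI, heq, ?_⟩
  rw [heq]
  exact integral_mono_ae hI hdom (hbound.mono fun z hz => (le_abs_self _).trans hz)

/-- **`d` is lower semicontinuous for `d_w`** (Lemma `basic`, part 3): if `ν_n ∈ X_R`,
`ν, θ ∈ X_R` and `d_w(ν_n, ν) → 0`, then `liminf_n d²(ν_n, θ) ≥ d²(ν, θ)`. -/
theorem d_lsc_for_dw (Rv R : ℝ) (hRv : 0 < Rv) (hR : 0 < R)
    (μ : Measure ℝ) [SigmaFinite μ] (hA : μ ((Set.Icc (-Rv) (Rv + 1))ᶜ) = 0)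
    (h : ℝ → ℝ) (hh0 : ∀ a, 0 ≤ h a) (hhint : Integrable h μ) (hh1 : (∫ a, h a ∂μ) = 1)
    (νn : ℕ → ℝ → Measure ℝ) (ν θ : ℝ → Measure ℝ)
    (hνn : ∀ n, IsXR μ h R (νn n)) (hν : IsXR μ h R ν) (hθ : IsXR μ h R θ)
    (hconv : Tendsto (fun n => dw μ (νn n) ν) atTop (nhds 0)) :
    dsq μ ν θ ≤ Filter.liminf (fun n => dsq μ (νn n) θ) atTop := by
  obtain ⟨κ, hκsf, hκfin, hκs, hκae, hκm, hκP⟩ := hν.exists_kernel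
  obtain ⟨η, hηsf, hηfin, hηs, hηae, hηm, -⟩ := hθ.exists_kernel
  choose κn hnsf hnfin hns hnae hnm hnP using fun n => (hνn n).exists_kernel
  have hP := isProbabilityMeasure_compProd hh0 hhint hh1 hκm
  have hPn := fun n => isProbabilityMeasure_compProd hh0 hhint hh1 (hnm n)
  set B := max (Rv + 1) R with hBdef
  have hB : ∀ᵐ a ∂μ, |a| ≤ B := by
    have : ∀ᵐ a ∂μ, a ∈ Set.Icc (-Rv) (Rv + 1) := hA
    filter_upwards [this] with a ha
    exact (abs_le.2 ⟨by linarith [ha.1], ha.2⟩).trans (le_max_left _ _)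
  have hW : Tendsto (fun n => W2sqProd (μ.compProd (κn n)) (μ.compProd κ)) atTop (nhds 0) := by
    have := hconv.pow 2
    simpa only [dw, Real.sq_sqrt (W2sqProd_nonneg _ _), hnP, hκP, ne_eq, OfNat.ofNat_ne_zero,
      not_false_eq_true, zero_pow] using this
  set π := μ.prod (boxMeasure R) with hπ
  obtain ⟨hI, hD, -⟩ := dsq_eq_integral_costDensity hR hh0 hhint hκae hηae hκm hηm hκs hηs
  have hDn := fun n => dsq_eq_integral_costDensity hR hh0 hhint (hnae n) hηae (hnm n) hηm
    (hns n) hηs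
  set S : Set (ℝ × ℝ × ℝ) := {z | kernelCdf κ z.1 z.2.1 ≤ kernelCdf η z.1 z.2.2} with hS
  have hSm : MeasurableSet S := measurableSet_le (by fun_prop) (by fun_prop)
  set χ : ℝ × ℝ × ℝ → ℝ := S.indicator 1 with hχ
  have hχm : Measurable χ := measurable_one.indicator hSm
  have hχ01 : ∀ z, χ z = 0 ∨ χ z = 1 := fun z => by
    by_cases hz : z ∈ S <;> simp [hχ, hz]
  set β : ℝ × ℝ × ℝ → ℝ := fun z => edgeWeight R z.2.1 - 2 * χ z with hβ
  have hβm : Measurable β := by fun_prop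
  have hmem : ∀ᵐ z ∂π, z.2.1 ∈ Set.Icc (-R) R ∧ z.2.2 ∈ Set.Icc (-R) R :=
    Measure.quasiMeasurePreserving_snd.ae (ae_mem_boxMeasure R)
  have hβb : ∀ᵐ z ∂π, |β z| ≤ 2 := by
    filter_upwards [hmem] with z hz
    obtain ⟨w0, w1⟩ := edgeWeight_mem_Icc hR hz.1
    rw [abs_le]
    rcases hχ01 z with h | h <;> simp only [hβ, h] <;> constructor <;> linarith
  have hlim := tendsto_integral_mul_kernelCdf hR hh0 hhint hnm hκm
    (fun n => ae_bounded_compProd hB (le_max_right _ _) (hns n))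
    (ae_bounded_compProd hB (le_max_right _ _) hκs) hW hβm hβb
  have hdom : Integrable (fun z : ℝ × ℝ × ℝ => 2 * h z.1) π :=
    (integrable_prod_boxMeasure hhint).const_mul 2
  have hIβ : ∀ (ζ : ProbabilityTheory.Kernel ℝ ℝ) [ProbabilityTheory.IsSFiniteKernel ζ],
      (∀ᵐ a ∂μ, ζ a Set.univ = ENNReal.ofReal (h a)) →
      Integrable (fun z => β z * kernelCdf ζ z.1 z.2.1) π := by
    intro ζ _ hζ
    refine hdom.mono' (Measurable.aestronglyMeasurable (by fun_prop)) ?_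
    filter_upwards [hβb, ae_prod_boxMeasure hζ] with z h1 h2
    obtain ⟨a0, a1⟩ := kernelCdf_mem_Icc (hh0 _) h2 z.2.1
    rw [norm_mul, Real.norm_of_nonneg a0]
    exact mul_le_mul h1 a1 a0 zero_le_two
  set r : ℝ × ℝ × ℝ → ℝ := fun z =>
    (edgeWeight R z.2.2 - 2 * (1 - χ z)) * kernelCdf η z.1 z.2.2 with hr
  have hIr : Integrable r π := by
    refine hdom.mono' (Measurable.aestronglyMeasurable (by fun_prop)) ?_
    filter_upwards [hmem, ae_prod_boxMeasure hηm] with z hz h2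
    obtain ⟨a0, a1⟩ := kernelCdf_mem_Icc (hh0 _) h2 z.2.2
    obtain ⟨w0, w1⟩ := edgeWeight_mem_Icc hR hz.2
    rw [hr, norm_mul, Real.norm_of_nonneg a0]
    refine mul_le_mul ?_ a1 a0 zero_le_two
    rw [Real.norm_eq_abs, abs_le]
    rcases hχ01 z with h | h <;> simp only [h] <;> constructor <;> linarith
  have hDlim : dsq μ ν θ = ∫ z, β z * kernelCdf κ z.1 z.2.1 ∂π + ∫ z, r z ∂π := by
    rw [hD, ← integral_add (hIβ κ hκm) hIr]
    refine integral_congr_ae (ae_of_all _ fun z => ?_)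
    simp only [costDensity, hβ, hr]
    by_cases hz : z ∈ S
    · have h1 : χ z = 1 := by simp [hχ, hz]
      rw [min_eq_left hz, h1]
      ring
    · have h1 : χ z = 0 := by simp [hχ, hz]
      rw [min_eq_right (le_of_not_ge hz), h1]
      ring
  have hDle : ∀ n, ∫ z, β z * kernelCdf (κn n) z.1 z.2.1 ∂π + ∫ z, r z ∂π ≤
      dsq μ (νn n) θ := by
    intro n
    obtain ⟨hIn, hen, -⟩ := hDn n
    rw [hen, ← integral_add (hIβ _ (hnm n)) hIr]
    refine integral_mono ((hIβ _ (hnm n)).add hIr) hIn fun z => ?_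
    simp only [costDensity, hβ, hr]
    have m1 := min_le_left (kernelCdf (κn n) z.1 z.2.1) (kernelCdf η z.1 z.2.2)
    have m2 := min_le_right (kernelCdf (κn n) z.1 z.2.1) (kernelCdf η z.1 z.2.2)
    rcases hχ01 z with h | h <;> rw [h] <;> linarith
  have hlim' := hlim.add_const (∫ z, r z ∂π)
  rw [← hDlim] at hlim'
  rw [← hlim'.liminf_eq]
  exact liminf_le_liminf (Eventually.of_forall hDle) hlim'.isBoundedUnder_ge
    (isBoundedUnder_of ⟨_, fun n => (hDn n).2.2⟩).isCoboundedUnder_ge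
end

section
/- J is convex along interpolations induced by transport plans: let ν, θ ∈ X_R, let γ = (γ^a)_{a∈A} be a μ-measurable family of transport plans with γ^a ∈ Π(ν^a, θ^a), and for ε ∈ [0,1] define ν_ε = (((1−ε)π₁ + επ₂)_# γ^a)_{a∈A}, where π₁(x,y) = x and π₂(x,y) = y. Then J(ν_ε) ≤ (1−ε)J(ν) + εJ(θ) for every ε ∈ [0,1]. In particular the same inequality holds when ν_ε = (id + εξ)_# ν for any ξ = (ξ^a)_{a∈A} ∈ L^∞(ν⊗μ), i.e. ν_ε^a = (id + εξ^a)_# ν^a. -/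
open MeasureTheory Filter

section FamilyMeasure

variable {E : Type*} [MeasurableSpace E]

/-- The measure `∫_A δ_a ⊗ κ^a dμ(a)` on `ℝ × E` associated with a family `κ` of measures. -/
noncomputable def familyMeasure (μ : Measure ℝ) (κ : ℝ → Measure E) : Measure (ℝ × E) :=
  μ.bind fun a => (κ a).map (Prod.mk a)

theorem aemeasurable_map_prodMk {μ : Measure ℝ} {κ : ℝ → Measure E}
    (hmeas : ∀ s, MeasurableSet s → Measurable fun a => κ a s)
    (hfin : ∀ᵐ a ∂μ, κ a Set.univ ≠ ⊤) :
    AEMeasurable (fun a => (κ a).map (Prod.mk a)) μ := by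
  classical
  have hS : MeasurableSet {a | κ a Set.univ ≠ ⊤} :=
    (hmeas _ MeasurableSet.univ (measurableSet_singleton ⊤)).compl
  have hκ : Measurable κ := Measure.measurable_of_measurable_coe _ hmeas
  let κ' : ProbabilityTheory.Kernel ℝ E :=
    ⟨fun a => if κ a Set.univ ≠ ⊤ then κ a else 0, Measurable.ite hS hκ measurable_const⟩
  have hκ' : ∀ a, IsFiniteMeasure (κ' a) := by
    intro a
    by_cases ha : κ a Set.univ ≠ ⊤
    · have : κ' a = κ a := if_pos ha
      rw [this]
      exact ⟨ha.lt_top⟩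
    · have : κ' a = 0 := if_neg ha
      rw [this]
      infer_instance
  refine ⟨fun a => (κ' a).map (Prod.mk a), ?_, ?_⟩
  · refine Measure.measurable_of_measurable_coe _ fun s hs => ?_
    simp only [Measure.map_apply measurable_prodMk_left hs]
    exact ProbabilityTheory.Kernel.measurable_kernel_prodMk_left_of_finite hs hκ'
  · filter_upwards [hfin] with a ha
    have : κ' a = κ a := if_pos ha
    simp only [this]

theorem familyMeasure_apply {μ : Measure ℝ} {κ : ℝ → Measure E}
    (hmeas : ∀ s, MeasurableSet s → Measurable fun a => κ a s)
    (hfin : ∀ᵐ a ∂μ, κ a Set.univ ≠ ⊤) {s : Set (ℝ × E)} (hs : MeasurableSet s) :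
    familyMeasure μ κ s = ∫⁻ a, κ a (Prod.mk a ⁻¹' s) ∂μ := by
  rw [familyMeasure, Measure.bind_apply hs (aemeasurable_map_prodMk hmeas hfin)]
  simp only [Measure.map_apply measurable_prodMk_left hs]

theorem ae_familyMeasure {μ : Measure ℝ} {κ : ℝ → Measure E}
    (hmeas : ∀ s, MeasurableSet s → Measurable fun a => κ a s)
    (hfin : ∀ᵐ a ∂μ, κ a Set.univ ≠ ⊤) {p : ℝ × E → Prop} (hp : MeasurableSet {q | p q})
    (h : ∀ᵐ a ∂μ, ∀ᵐ x ∂κ a, p (a, x)) : ∀ᵐ q ∂familyMeasure μ κ, p q := by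
  change familyMeasure μ κ {q | p q}ᶜ = 0
  rw [familyMeasure_apply hmeas hfin hp.compl]
  exact (lintegral_congr_ae h).trans lintegral_zero

theorem nuOtimes_map {μ : Measure ℝ} {κ : ℝ → Measure E}
    (hmeas : ∀ s, MeasurableSet s → Measurable fun a => κ a s)
    (hfin : ∀ᵐ a ∂μ, κ a Set.univ ≠ ⊤) {T : ℝ × E → ℝ} (hT : Measurable T) :
    nuOtimes μ (fun a => (κ a).map fun x => T (a, x))
      = (familyMeasure μ κ).map fun q => (q.1, T q) := by
  have hg : Measurable fun q : ℝ × E => (q.1, T q) := measurable_fst.prodMk hT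
  have key : (fun a => ((κ a).map fun x => T (a, x)).map fun x => (a, x))
      = fun a => ((κ a).map (Prod.mk a)).map fun q => (q.1, T q) := by
    funext a
    have hTa : Measurable fun x => T (a, x) := hT.comp measurable_prodMk_left
    have ha : Measurable fun x : ℝ => (a, x) := measurable_prodMk_left
    rw [Measure.map_map ha hTa, Measure.map_map hg measurable_prodMk_left]
    rfl
  have hae := aemeasurable_map_prodMk hmeas hfin
  have hae' : AEMeasurable
      (fun a => ((κ a).map (Prod.mk a)).map fun q => (q.1, T q)) μ :=
    (Measure.measurable_map _ hg).comp_aemeasurable hae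
  ext s hs
  rw [nuOtimes, key, Measure.bind_apply hs hae',
    Measure.map_apply hg hs, familyMeasure, Measure.bind_apply (hg hs) hae]
  simp only [Measure.map_apply hg hs]

theorem Jen_congr {μ : Measure ℝ} {ν θ : ℝ → Measure ℝ} (h : ν =ᵐ[μ] θ) :
    Jen μ ν = Jen μ θ := by
  have : nuOtimes μ ν = nuOtimes μ θ :=
    Measure.bind_congr_right (h.mono fun a ha => by simp only [ha])
  simp only [Jen, J0, J1, this]

theorem Jen_map {μ : Measure ℝ} {κ : ℝ → Measure E}
    (hmeas : ∀ s, MeasurableSet s → Measurable fun a => κ a s)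
    (hfin : ∀ᵐ a ∂μ, κ a Set.univ ≠ ⊤) [IsFiniteMeasure (familyMeasure μ κ)]
    {T : ℝ × E → ℝ} (hT : Measurable T) :
    Jen μ (fun a => (κ a).map fun x => T (a, x))
      = (1 / 4) * ∫ q, |T q.1 - T q.2| ∂((familyMeasure μ κ).prod (familyMeasure μ κ))
        + ∫ q, (1 / 2 - q.1) * T q ∂(familyMeasure μ κ) := by
  have hg : Measurable fun q : ℝ × E => (q.1, T q) := measurable_fst.prodMk hT
  rw [Jen, J0, J1, nuOtimes_map hmeas hfin hT, Measure.map_prod_map _ _ hg hg,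
    integral_map (hg.prodMap hg).aemeasurable, integral_map hg.aemeasurable]
  · rfl
  · exact Measurable.aestronglyMeasurable (by fun_prop)
  · exact Measurable.aestronglyMeasurable (by fun_prop)

/-- Convexity of `Jen` along the interpolation of two bounded images of a family of measures. -/
theorem Jen_map_convex {μ : Measure ℝ} {κ : ℝ → Measure E} {h : ℝ → ℝ} {K C : ℝ}
    (hK : ∀ᵐ a ∂μ, |a| ≤ K) (hh : Integrable h μ)
    (hmeas : ∀ s, MeasurableSet s → Measurable fun a => κ a s)
    (hmass : ∀ᵐ a ∂μ, κ a Set.univ = ENNReal.ofReal (h a))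
    {S T : ℝ × E → ℝ} (hS : Measurable S) (hT : Measurable T)
    (hb : ∀ᵐ a ∂μ, ∀ᵐ x ∂κ a, |S (a, x)| ≤ C ∧ |T (a, x)| ≤ C)
    {ε : ℝ} (hε : ε ∈ Set.Icc (0 : ℝ) 1) :
    Jen μ (fun a => (κ a).map fun x => (1 - ε) * S (a, x) + ε * T (a, x))
      ≤ (1 - ε) * Jen μ (fun a => (κ a).map fun x => S (a, x))
        + ε * Jen μ (fun a => (κ a).map fun x => T (a, x)) := by
  obtain ⟨hε0, hε1⟩ := hε
  have hfin : ∀ᵐ a ∂μ, κ a Set.univ ≠ ⊤ := hmass.mono fun a ha => by simp [ha]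
  have hM : IsFiniteMeasure (familyMeasure μ κ) := by
    refine ⟨?_⟩
    rw [familyMeasure_apply hmeas hfin MeasurableSet.univ]
    simp only [Set.preimage_univ]
    rw [lintegral_congr_ae hmass]
    exact hh.lintegral_lt_top
  have hset : MeasurableSet {q | |S q| ≤ C ∧ |T q| ≤ C} := by measurability
  have hbM : ∀ᵐ q ∂familyMeasure μ κ, |S q| ≤ C ∧ |T q| ≤ C :=
    ae_familyMeasure hmeas hfin hset hb
  have hKM : ∀ᵐ q ∂familyMeasure μ κ, |q.1| ≤ K :=
    ae_familyMeasure hmeas hfin (measurableSet_le (by fun_prop) (by fun_prop))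
      (hK.mono fun a ha => ae_of_all _ fun _ => ha)
  set M := familyMeasure μ κ with hMdef
  have intS : Integrable S M :=
    .of_bound hS.aestronglyMeasurable C (hbM.mono fun q hq => hq.1)
  have intT : Integrable T M :=
    .of_bound hT.aestronglyMeasurable C (hbM.mono fun q hq => hq.2)
  have int0 : ∀ {U : ℝ × E → ℝ}, Integrable U M →
      Integrable (fun q : (ℝ × E) × (ℝ × E) => |U q.1 - U q.2|) (M.prod M) := fun hU =>
    ((hU.comp_fst M).sub (hU.comp_snd M)).abs
  have int1 : ∀ {U : ℝ × E → ℝ}, Integrable U M →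
      Integrable (fun q : ℝ × E => (1 / 2 - q.1) * U q) M := fun hU => by
    refine hU.bdd_mul (c := 1 / 2 + K) (Measurable.aestronglyMeasurable (by fun_prop)) ?_
    filter_upwards [hKM] with q hq
    rw [Real.norm_eq_abs, abs_le] at *
    constructor <;> linarith [hq.1, hq.2]
  have hU : Measurable fun q => (1 - ε) * S q + ε * T q := by fun_prop
  have intU : Integrable (fun q => (1 - ε) * S q + ε * T q) M :=
    (intS.const_mul _).add (intT.const_mul _)
  have e1 := Jen_map hmeas hfin hU
  have e2 : ∫ q, (1 / 2 - q.1) * ((1 - ε) * S q + ε * T q) ∂M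
      = (1 - ε) * ∫ q, (1 / 2 - q.1) * S q ∂M + ε * ∫ q, (1 / 2 - q.1) * T q ∂M := by
    rw [← integral_const_mul, ← integral_const_mul,
      ← integral_add ((int1 intS).const_mul _) ((int1 intT).const_mul _)]
    exact integral_congr_ae (ae_of_all _ fun q => by ring)
  have e3 : ∫ q, |((1 - ε) * S q.1 + ε * T q.1) - ((1 - ε) * S q.2 + ε * T q.2)| ∂(M.prod M)
      ≤ (1 - ε) * ∫ q, |S q.1 - S q.2| ∂(M.prod M) + ε * ∫ q, |T q.1 - T q.2| ∂(M.prod M) := by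
    rw [← integral_const_mul, ← integral_const_mul,
      ← integral_add ((int0 intS).const_mul _) ((int0 intT).const_mul _)]
    refine integral_mono (int0 intU) (((int0 intS).const_mul _).add ((int0 intT).const_mul _))
      fun q => ?_
    calc |((1 - ε) * S q.1 + ε * T q.1) - ((1 - ε) * S q.2 + ε * T q.2)|
        = |(1 - ε) * (S q.1 - S q.2) + ε * (T q.1 - T q.2)| := by ring_nf
      _ ≤ |(1 - ε) * (S q.1 - S q.2)| + |ε * (T q.1 - T q.2)| := abs_add_le _ _
      _ = (1 - ε) * |S q.1 - S q.2| + ε * |T q.1 - T q.2| := by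
        rw [abs_mul, abs_mul, abs_of_nonneg hε0, abs_of_nonneg (sub_nonneg.2 hε1)]
  rw [e1, Jen_map hmeas hfin hS, Jen_map hmeas hfin hT, ← hMdef, e2]
  linarith

end FamilyMeasure

theorem IsXR.ae_abs_le {μ : Measure ℝ} {h : ℝ → ℝ} {R : ℝ} {ν : ℝ → Measure ℝ}
    (hν : IsXR μ h R ν) : ∀ᵐ a ∂μ, ∀ᵐ x ∂ν a, |x| ≤ R := by
  filter_upwards [hν.supp] with a ha
  have : ∀ᵐ x ∂ν a, x ∈ Set.Icc (-R) R := ha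
  exact this.mono fun x hx => abs_le.2 hx

/-- **Convexity of `J` along interpolations induced by transport plans** (Lemma `convex`):
for `ν, θ ∈ X_R` and a `μ`-measurable family of plans `γ^a ∈ Π(ν^a, θ^a)`, setting
`ν_ε^a = ((1−ε)π₁ + επ₂)_# γ^a`, one has `J(ν_ε) ≤ (1−ε)J(ν) + εJ(θ)` for all `ε ∈ [0,1]`.
In particular the same holds when `ν_ε = (id + εξ)_# ν` for bounded measurable `ξ`. -/
theorem Jen_convex_along_plans (Rv R : ℝ) (hRv : 0 < Rv) (hR : 0 < R)
    (μ : Measure ℝ) [SigmaFinite μ] (hA : μ ((Set.Icc (-Rv) (Rv + 1))ᶜ) = 0)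
    (h : ℝ → ℝ) (hh0 : ∀ a, 0 ≤ h a) (hhint : Integrable h μ) (hh1 : (∫ a, h a ∂μ) = 1)
    (ν θ : ℝ → Measure ℝ) (hν : IsXR μ h R ν) (hθ : IsXR μ h R θ) :
    (∀ γ : ℝ → Measure (ℝ × ℝ), IsPlanFamily μ ν θ γ →
      ∀ ε ∈ Set.Icc (0 : ℝ) 1,
        Jen μ (fun a => (γ a).map fun p : ℝ × ℝ => (1 - ε) * p.1 + ε * p.2)
          ≤ (1 - ε) * Jen μ ν + ε * Jen μ θ) ∧
    (∀ ξ : ℝ → ℝ → ℝ, Measurable (Function.uncurry ξ) → (∃ C : ℝ, ∀ a x, |ξ a x| ≤ C) →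
      ∀ ε ∈ Set.Icc (0 : ℝ) 1,
        Jen μ (fun a => (ν a).map fun x => x + ε * ξ a x)
          ≤ (1 - ε) * Jen μ ν + ε * Jen μ (fun a => (ν a).map fun x => x + ξ a x)) := by
  have hK : ∀ᵐ a ∂μ, |a| ≤ Rv + 1 := by
    have : ∀ᵐ a ∂μ, a ∈ Set.Icc (-Rv) (Rv + 1) := hA
    exact this.mono fun a ha => abs_le.2 ⟨by linarith [ha.1], ha.2⟩
  refine ⟨fun γ hγ ε hε => ?_, fun ξ hξ ⟨C, hC⟩ ε hε => ?_⟩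
  · have hmass : ∀ᵐ a ∂μ, γ a Set.univ = ENNReal.ofReal (h a) := by
      filter_upwards [hν.mass, hγ.fst] with a ha hfst
      rw [← ha, ← hfst, Measure.map_apply measurable_fst MeasurableSet.univ, Set.preimage_univ]
    have hb : ∀ᵐ a ∂μ, ∀ᵐ p ∂γ a, |p.1| ≤ R ∧ |p.2| ≤ R := by
      filter_upwards [hν.ae_abs_le, hθ.ae_abs_le, hγ.fst, hγ.snd] with a h1 h2 hfst hsnd
      rw [← hfst] at h1
      rw [← hsnd] at h2
      exact (ae_of_ae_map measurable_fst.aemeasurable h1).and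
        (ae_of_ae_map measurable_snd.aemeasurable h2)
    have key := Jen_map_convex hK hhint hγ.meas hmass (S := fun q => q.2.1)
      (T := fun q => q.2.2) (by fun_prop) (by fun_prop) hb hε
    rwa [Jen_congr hγ.fst, Jen_congr hγ.snd] at key
  · have hξ' : Measurable fun q : ℝ × ℝ => ξ q.1 q.2 := hξ
    have hb : ∀ᵐ a ∂μ, ∀ᵐ x ∂ν a, |x| ≤ R + C ∧ |x + ξ a x| ≤ R + C := by
      filter_upwards [hν.ae_abs_le] with a ha
      filter_upwards [ha] with x hx
      have := hC a x
      exact ⟨by linarith [abs_nonneg (ξ a x)], (abs_add_le _ _).trans (by linarith)⟩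
    have key := Jen_map_convex hK hhint hν.meas hν.mass (S := fun q => q.2)
      (T := fun q => q.2 + ξ q.1 q.2) (by fun_prop) (by fun_prop) hb hε
    have hid : ∀ a, (ν a).map (fun x => x) = ν a := fun a => Measure.map_id
    have hcomb : ∀ a x, (1 - ε) * x + ε * (x + ξ a x) = x + ε * ξ a x := fun a x => by ring
    simpa only [hid, hcomb] using key
end

section
/- Let ν ∈ X_R and suppose w = (w^a)_{a∈A} ∈ ∂J(ν). Define ρ = ∫_A ν^a dμ(a), G(x) = ρ((−∞, x]) and G⁻(x) = ρ((−∞, x)). Then w^a(x) ∈ [G⁻(x) − a, G(x) − a] for ν⊗μ-almost every (a, x). In particular w ∈ L^∞(ν⊗μ) with ‖w‖_{L^∞(ν⊗μ)} ≤ R_v + 2. -/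
open MeasureTheory Filter

open scoped Topology ProbabilityTheory

/-- The energy of a family, as a function of the associated measure on label-position pairs. -/
noncomputable def pairEnergy (m : Measure (ℝ × ℝ)) : ℝ :=
  (1 / 4) * (∫ q, |q.1.2 - q.2.2| ∂(m.prod m)) + ∫ p, (1 / 2 - p.1) * p.2 ∂m

/-- Displacement of the position by `ε * φ`, with the label kept fixed. -/
def displace (φ : ℝ × ℝ → ℝ) (ε : ℝ) (p : ℝ × ℝ) : ℝ × ℝ := (p.1, p.2 + ε * φ p)

/-- The one-sided directional derivative of `|·|` at `d` in direction `c`. -/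
noncomputable def absDirDeriv (d c : ℝ) : ℝ :=
  if d = 0 then |c| else if 0 < d then c else -c

lemma tendsto_abs_slope (d c : ℝ) :
    Tendsto (fun ε : ℝ => (|d + ε * c| - |d|) / ε) (𝓝[>] 0) (𝓝 (absDirDeriv d c)) := by
  refine tendsto_const_nhds.congr' ?_
  have hpos : ∀ᶠ ε : ℝ in 𝓝[>] 0, 0 < ε := self_mem_nhdsWithin
  have hcont : Tendsto (fun ε : ℝ => d + ε * c) (𝓝[>] 0) (𝓝 d) := by
    have : Continuous fun ε : ℝ => d + ε * c := by fun_prop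
    simpa using (this.tendsto 0).mono_left nhdsWithin_le_nhds
  unfold absDirDeriv
  rcases lt_trichotomy d 0 with hd | hd | hd
  · filter_upwards [hpos, hcont.eventually_lt_const hd] with ε hε h
    rw [if_neg hd.ne, if_neg hd.not_gt, abs_of_neg h, abs_of_neg hd]
    field_simp
    ring
  · filter_upwards [hpos] with ε hε
    simp [hd, abs_mul, abs_of_pos hε]
    field_simp
  · filter_upwards [hpos, hcont.eventually_const_lt hd] with ε hε h
    rw [if_neg hd.ne', if_pos hd, abs_of_pos h, abs_of_pos hd]
    field_simp
    ring

lemma abs_abs_slope_le (d c : ℝ) {ε : ℝ} (hε : 0 < ε) : |(|d + ε * c| - |d|) / ε| ≤ |c| := by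
  rw [abs_div, abs_of_pos hε, div_le_iff₀ hε]
  calc |(|d + ε * c| - |d|)| ≤ |d + ε * c - d| := abs_abs_sub_abs_le _ _
    _ = |c| * ε := by rw [add_sub_cancel_left, abs_mul, abs_of_pos hε, mul_comm]

lemma measurable_displace {φ : ℝ × ℝ → ℝ} (hφ : Measurable φ) (ε : ℝ) :
    Measurable (displace φ ε) := by
  unfold displace; fun_prop

section PairEnergy

variable {m : Measure (ℝ × ℝ)} [IsProbabilityMeasure m] {φ : ℝ × ℝ → ℝ}

lemma integrable_of_measurable_of_abs_le {Ω : Type*} [MeasurableSpace Ω] {P : Measure Ω}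
    [IsFiniteMeasure P] {f : Ω → ℝ} (hf : Measurable f) {C : ℝ} (hC : ∀ x, |f x| ≤ C) :
    Integrable f P :=
  Integrable.of_bound hf.aestronglyMeasurable C (ae_of_all _ hC)

lemma pairEnergy_map_displace_sub (hx : Integrable (fun p : ℝ × ℝ => p.2) m)
    (ha : Integrable (fun p : ℝ × ℝ => p.1) m)
    (hax : Integrable (fun p : ℝ × ℝ => (1 / 2 - p.1) * p.2) m)
    (hφ : Measurable φ) (hφ1 : ∀ p, |φ p| ≤ 1) {ε : ℝ} (hε : 0 < ε) :
    pairEnergy (m.map (displace φ ε)) - pairEnergy m =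
      ε * ((1 / 4) * (∫ q, (|q.1.2 - q.2.2 + ε * (φ q.1 - φ q.2)| - |q.1.2 - q.2.2|) / ε
        ∂(m.prod m)) + ∫ p, (1 / 2 - p.1) * φ p ∂m) := by
  have hT := measurable_displace hφ ε
  have hφi : Integrable φ m := integrable_of_measurable_of_abs_le hφ hφ1
  have haφ : Integrable (fun p : ℝ × ℝ => (1 / 2 - p.1) * φ p) m := by
    refine Integrable.mul_bdd (c := 1) ((integrable_const _).sub ha) hφ.aestronglyMeasurable ?_
    exact ae_of_all _ hφ1
  have hd : Integrable (fun q : (ℝ × ℝ) × (ℝ × ℝ) => q.1.2 - q.2.2) (m.prod m) :=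
    (hx.comp_fst m).sub (hx.comp_snd m)
  have hc : Integrable (fun q : (ℝ × ℝ) × (ℝ × ℝ) => ε * (φ q.1 - φ q.2)) (m.prod m) :=
    ((hφi.comp_fst m).sub (hφi.comp_snd m)).const_mul ε
  have h1 : ∫ q, |q.1.2 - q.2.2| ∂((m.map (displace φ ε)).prod (m.map (displace φ ε))) =
      ∫ q, |q.1.2 - q.2.2 + ε * (φ q.1 - φ q.2)| ∂(m.prod m) := by
    rw [Measure.map_prod_map _ _ hT hT, integral_map (by fun_prop)
      (by fun_prop)]
    congr 1 with q
    simp only [Prod.map, displace]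
    congr 1; ring
  have h2 : ∫ p, (1 / 2 - p.1) * p.2 ∂(m.map (displace φ ε)) =
      (∫ p, (1 / 2 - p.1) * p.2 ∂m) + ε * ∫ p, (1 / 2 - p.1) * φ p ∂m := by
    rw [integral_map hT.aemeasurable (by fun_prop), ← integral_const_mul,
      ← integral_add hax (haφ.const_mul ε)]
    congr 1 with p
    simp only [displace]
    ring
  have h3 := integral_sub (hd.add hc).abs hd.abs
  simp only [Pi.add_apply] at h3
  rw [integral_div, h3]
  unfold pairEnergy
  rw [h1, h2]
  field_simp
  ring

/-- First-order consequence of a subgradient inequality along displacements in direction `φ`, given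
a symmetric majorant of the directional derivative of the interaction kernel. -/
lemma integral_mul_le_of_subgradient (hx : Integrable (fun p : ℝ × ℝ => p.2) m)
    (ha : Integrable (fun p : ℝ × ℝ => p.1) m)
    (hax : Integrable (fun p : ℝ × ℝ => (1 / 2 - p.1) * p.2) m)
    (hφ : Measurable φ) (hφ1 : ∀ p, |φ p| ≤ 1) {u : ℝ × ℝ → ℝ} {k : ℝ → ℝ → ℝ}
    (hk : Measurable (Function.uncurry k)) (hk1 : ∀ x y, |k x y| ≤ 1)
    (hmaj : ∀ p q : ℝ × ℝ, absDirDeriv (p.2 - q.2) (φ p - φ q) ≤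
      φ p * (2 * k p.2 q.2 - 1) + φ q * (2 * k q.2 p.2 - 1))
    (hsub : ∀ ε ∈ Set.Ioo (0 : ℝ) 1,
      ε * ∫ p, φ p * u p ∂m ≤ pairEnergy (m.map (displace φ ε)) - pairEnergy m) :
    ∫ p, φ p * u p ∂m ≤ ∫ p, φ p * ((∫ q, k p.2 q.2 ∂m) - p.1) ∂m := by
  have hφi : Integrable φ m := integrable_of_measurable_of_abs_le hφ hφ1
  have hφa : Integrable (fun p : ℝ × ℝ => φ p * p.1) m :=
    ha.bdd_mul (c := 1) hφ.aestronglyMeasurable (ae_of_all _ hφ1)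
  have hk' : Measurable fun q : (ℝ × ℝ) × (ℝ × ℝ) => k q.1.2 q.2.2 :=
    hk.comp (by fun_prop : Measurable fun q : (ℝ × ℝ) × (ℝ × ℝ) => (q.1.2, q.2.2))
  have hF : Integrable (fun q : (ℝ × ℝ) × (ℝ × ℝ) => φ q.1 * (2 * k q.1.2 q.2.2 - 1))
      (m.prod m) := by
    refine integrable_of_measurable_of_abs_le (C := 3) (by fun_prop) fun q => ?_
    have h1 := abs_le.1 (hk1 q.1.2 q.2.2)
    have h2 : |2 * k q.1.2 q.2.2 - 1| ≤ 3 := abs_le.2 ⟨by linarith, by linarith⟩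
    rw [abs_mul]
    nlinarith [hφ1 q.1, abs_nonneg (φ q.1), abs_nonneg (2 * k q.1.2 q.2.2 - 1)]
  have hlim : Tendsto (fun ε : ℝ => ∫ q : (ℝ × ℝ) × (ℝ × ℝ),
      (|q.1.2 - q.2.2 + ε * (φ q.1 - φ q.2)| - |q.1.2 - q.2.2|) / ε ∂(m.prod m)) (𝓝[>] 0)
      (𝓝 (∫ q : (ℝ × ℝ) × (ℝ × ℝ), absDirDeriv (q.1.2 - q.2.2) (φ q.1 - φ q.2) ∂(m.prod m))) := by
    refine tendsto_integral_filter_of_dominated_convergence (fun _ => 2) ?_ ?_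
      (integrable_const _) (ae_of_all _ fun q => tendsto_abs_slope _ _)
    · refine Eventually.of_forall fun ε => Measurable.aestronglyMeasurable ?_
      have : Measurable fun x : ℝ => |x| := continuous_abs.measurable
      fun_prop
    · filter_upwards [self_mem_nhdsWithin] with ε hε
      refine ae_of_all _ fun q => (abs_abs_slope_le _ _ hε).trans ?_
      have h1 := abs_le.1 (hφ1 q.1)
      have h2 := abs_le.1 (hφ1 q.2)
      exact abs_le.2 ⟨by linarith, by linarith⟩
  have hle : ∫ p, φ p * u p ∂m ≤ (1 / 4) * (∫ q : (ℝ × ℝ) × (ℝ × ℝ),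
      absDirDeriv (q.1.2 - q.2.2) (φ q.1 - φ q.2) ∂(m.prod m)) + ∫ p, (1 / 2 - p.1) * φ p ∂m := by
    refine ge_of_tendsto ((hlim.const_mul _).add_const _) ?_
    filter_upwards [Ioo_mem_nhdsGT (zero_lt_one' ℝ)] with ε hε
    have := hsub ε hε
    rw [pairEnergy_map_displace_sub hx ha hax hφ hφ1 hε.1] at this
    exact le_of_mul_le_mul_left this hε.1
  have hmajint : ∫ q : (ℝ × ℝ) × (ℝ × ℝ), absDirDeriv (q.1.2 - q.2.2) (φ q.1 - φ q.2) ∂(m.prod m) ≤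
      2 * ∫ q : (ℝ × ℝ) × (ℝ × ℝ), φ q.1 * (2 * k q.1.2 q.2.2 - 1) ∂(m.prod m) := by
    have hD : Integrable (fun q : (ℝ × ℝ) × (ℝ × ℝ) =>
        absDirDeriv (q.1.2 - q.2.2) (φ q.1 - φ q.2)) (m.prod m) := by
      refine integrable_of_measurable_of_abs_le (C := 2) ?_ fun q => ?_
      · unfold absDirDeriv
        have : Measurable fun x : ℝ => |x| := continuous_abs.measurable
        refine Measurable.ite (measurableSet_eq_fun (by fun_prop) (by fun_prop)) (by fun_prop) ?_
        exact Measurable.ite (measurableSet_lt (by fun_prop) (by fun_prop)) (by fun_prop)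
          (by fun_prop)
      · have h1 := abs_le.1 (hφ1 q.1)
        have h2 := abs_le.1 (hφ1 q.2)
        have h3 : |φ q.1 - φ q.2| ≤ 2 := abs_le.2 ⟨by linarith, by linarith⟩
        unfold absDirDeriv
        split_ifs <;> simpa only [abs_abs, abs_neg] using h3
    refine (integral_mono hD (hF.add hF.swap) fun q => hmaj q.1 q.2).trans (le_of_eq ?_)
    rw [integral_add' hF hF.swap]
    have := integral_prod_swap (μ := m) (ν := m)
      fun q : (ℝ × ℝ) × (ℝ × ℝ) => φ q.1 * (2 * k q.1.2 q.2.2 - 1)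
    simp only [Function.comp_def] at this ⊢
    rw [this]
    ring
  have hiter : ∫ q : (ℝ × ℝ) × (ℝ × ℝ), φ q.1 * (2 * k q.1.2 q.2.2 - 1) ∂(m.prod m) =
      ∫ p, φ p * (2 * (∫ q, k p.2 q.2 ∂m) - 1) ∂m := by
    rw [integral_prod _ hF]
    congr 1 with p
    have hkp : Integrable (fun q : ℝ × ℝ => k p.2 q.2) m := by
      refine integrable_of_measurable_of_abs_le ?_ fun q => hk1 p.2 q.2
      exact hk'.comp (by fun_prop : Measurable fun q : ℝ × ℝ => (p, q))
    simp only
    rw [integral_const_mul, integral_sub (hkp.const_mul 2) (integrable_const _),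
      integral_const_mul]
    simp
  have hint1 : Integrable (fun p => φ p * (2 * (∫ q, k p.2 q.2 ∂m) - 1)) m := by
    refine hF.integral_prod_left.congr (ae_of_all _ fun p => ?_)
    have hkp : Integrable (fun q : ℝ × ℝ => k p.2 q.2) m := by
      refine integrable_of_measurable_of_abs_le ?_ fun q => hk1 p.2 q.2
      exact hk'.comp (by fun_prop : Measurable fun q : ℝ × ℝ => (p, q))
    simp only
    rw [integral_const_mul, integral_sub (hkp.const_mul 2) (integrable_const _),
      integral_const_mul]
    simp
  have hint2 : Integrable (fun p : ℝ × ℝ => (1 / 2 - p.1) * φ p) m := by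
    refine ((hφi.const_mul (1 / 2)).sub hφa).congr (ae_of_all _ fun p => ?_)
    simp only [Pi.sub_apply]
    ring
  have hfinal : ∫ p, φ p * ((∫ q, k p.2 q.2 ∂m) - p.1) ∂m =
      (1 / 2) * (∫ p, φ p * (2 * (∫ q, k p.2 q.2 ∂m) - 1) ∂m) + ∫ p, (1 / 2 - p.1) * φ p ∂m := by
    rw [← integral_const_mul, ← integral_add (hint1.const_mul _) hint2]
    congr 1 with p
    ring
  rw [hfinal]
  rw [hiter] at hmajint
  linarith

/-- Elements of the subdifferential, tested against displacements only. -/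
lemma ae_mem_Icc_of_subgradient (hx : Integrable (fun p : ℝ × ℝ => p.2) m)
    (ha : Integrable (fun p : ℝ × ℝ => p.1) m)
    (hax : Integrable (fun p : ℝ × ℝ => (1 / 2 - p.1) * p.2) m)
    {u : ℝ × ℝ → ℝ} (hu : Integrable u m)
    (hsub : ∀ φ : ℝ × ℝ → ℝ, Measurable φ → (∀ p, |φ p| ≤ 1) → ∀ ε ∈ Set.Ioo (0 : ℝ) 1,
      ε * ∫ p, φ p * u p ∂m ≤ pairEnergy (m.map (displace φ ε)) - pairEnergy m) :
    ∀ᵐ p ∂m, u p ∈ Set.Icc ((m.map Prod.snd).real (Set.Iio p.2) - p.1)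
      ((m.map Prod.snd).real (Set.Iic p.2) - p.1) := by
  have hprob : IsProbabilityMeasure (m.map Prod.snd) :=
    Measure.isProbabilityMeasure_map measurable_snd.aemeasurable
  have hIic : ∀ x : ℝ, ∫ q : ℝ × ℝ, (if q.2 ≤ x then (1 : ℝ) else 0) ∂m =
      (m.map Prod.snd).real (Set.Iic x) := fun x => by
    rw [map_measureReal_apply measurable_snd measurableSet_Iic, ← integral_indicator_one
      (measurable_snd measurableSet_Iic)]
    rfl
  have hIio : ∀ x : ℝ, ∫ q : ℝ × ℝ, (if q.2 < x then (1 : ℝ) else 0) ∂m =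
      (m.map Prod.snd).real (Set.Iio x) := fun x => by
    rw [map_measureReal_apply measurable_snd measurableSet_Iio, ← integral_indicator_one
      (measurable_snd measurableSet_Iio)]
    rfl
  have hmIic : Measurable fun x : ℝ => (m.map Prod.snd).real (Set.Iic x) :=
    Monotone.measurable fun x y hxy => measureReal_mono (Set.Iic_subset_Iic.2 hxy)
  have hmIio : Measurable fun x : ℝ => (m.map Prod.snd).real (Set.Iio x) :=
    Monotone.measurable fun x y hxy => measureReal_mono (Set.Iio_subset_Iio hxy)
  have hiIic : Integrable (fun p : ℝ × ℝ => (m.map Prod.snd).real (Set.Iic p.2) - p.1) m := by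
    refine (integrable_of_measurable_of_abs_le (C := 1) (hmIic.comp measurable_snd) fun p => ?_).sub
      ha
    simp [abs_of_nonneg measureReal_nonneg, measureReal_le_one]
  have hiIio : Integrable (fun p : ℝ × ℝ => (m.map Prod.snd).real (Set.Iio p.2) - p.1) m := by
    refine (integrable_of_measurable_of_abs_le (C := 1) (hmIio.comp measurable_snd) fun p => ?_).sub
      ha
    simp [abs_of_nonneg measureReal_nonneg, measureReal_le_one]
  have hupper : u ≤ᵐ[m] fun p => (m.map Prod.snd).real (Set.Iic p.2) - p.1 := by
    refine ae_le_of_forall_setIntegral_le hu hiIic fun E hE _ => ?_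
    have hφ : Measurable (E.indicator (fun _ => (1 : ℝ))) := measurable_const.indicator hE
    have hφ1 : ∀ p, |E.indicator (fun _ => (1 : ℝ)) p| ≤ 1 := fun p => by
      by_cases hp : p ∈ E <;> simp [hp]
    have key := integral_mul_le_of_subgradient (k := fun x y => if y ≤ x then 1 else 0)
      hx ha hax hφ hφ1
      (Measurable.ite (measurableSet_le measurable_snd measurable_fst) measurable_const
        measurable_const) (fun x y => by split_ifs <;> simp) ?_ (hsub _ hφ hφ1)
    · simp only [hIic] at key
      rw [← integral_indicator hE, ← integral_indicator hE]
      refine (le_of_eq ?_).trans (key.trans (le_of_eq ?_)) <;>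
      · congr 1 with p
        by_cases hp : p ∈ E <;> simp [hp]
    · intro p q
      unfold absDirDeriv
      rcases lt_trichotomy p.2 q.2 with h | h | h
      · rw [if_neg (by linarith), if_neg (by linarith), if_neg (by linarith), if_pos h.le]
        linarith
      · by_cases hp : p ∈ E <;> by_cases hq : q ∈ E <;> simp [h, hp, hq] <;> norm_num
      · rw [if_neg (by linarith), if_pos (by linarith), if_pos h.le, if_neg (by linarith)]
        linarith
  have hlower : (fun p => (m.map Prod.snd).real (Set.Iio p.2) - p.1) ≤ᵐ[m] u := by
    refine ae_le_of_forall_setIntegral_le hiIio hu fun E hE _ => ?_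
    have hφ : Measurable (E.indicator (fun _ => (-1 : ℝ))) := measurable_const.indicator hE
    have hφ1 : ∀ p, |E.indicator (fun _ => (-1 : ℝ)) p| ≤ 1 := fun p => by
      by_cases hp : p ∈ E <;> simp [hp]
    have key := integral_mul_le_of_subgradient (k := fun x y => if y < x then 1 else 0)
      hx ha hax hφ hφ1
      (Measurable.ite (measurableSet_lt measurable_snd measurable_fst) measurable_const
        measurable_const) (fun x y => by split_ifs <;> simp) ?_ (hsub _ hφ hφ1)
    · simp only [hIio] at key
      rw [← integral_indicator hE, ← integral_indicator hE, ← neg_le_neg_iff, ← integral_neg,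
        ← integral_neg]
      refine (le_of_eq ?_).trans (key.trans (le_of_eq ?_)) <;>
      · congr 1 with p
        by_cases hp : p ∈ E <;> simp [hp]
    · intro p q
      unfold absDirDeriv
      rcases lt_trichotomy p.2 q.2 with h | h | h
      · rw [if_neg (by linarith), if_neg (by linarith), if_neg (by linarith), if_pos h]
        linarith
      · by_cases hp : p ∈ E <;> by_cases hq : q ∈ E <;> simp [h, hp, hq]
      · rw [if_neg (by linarith), if_pos (by linarith), if_pos h, if_neg (by linarith)]
        linarith
  filter_upwards [hupper, hlower] with p h1 h2 using ⟨h2, h1⟩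

end PairEnergy

section Kernel

open ProbabilityTheory

/-- The kernel `a ↦ δ_a ⊗ κ a`, pushed forward along a map of label-position pairs. -/
noncomputable def pushKernel {E : Type*} [MeasurableSpace E] (κ : Kernel ℝ ℝ) (f : ℝ × ℝ → E) :
    Kernel ℝ E :=
  (Kernel.id ×ₖ κ).map f

lemma pushKernel_apply {E : Type*} [MeasurableSpace E] (κ : Kernel ℝ ℝ) [IsSFiniteKernel κ]
    {f : ℝ × ℝ → E} (hf : Measurable f) (a : ℝ) :
    pushKernel κ f a = (κ a).map fun x => f (a, x) := by
  rw [pushKernel, Kernel.map_apply _ hf, Kernel.prod_apply, Kernel.id_apply,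
    Measure.dirac_prod, Measure.map_map hf (by fun_prop)]
  rfl

lemma nuOtimes_kernel (μ : Measure ℝ) [SFinite μ] (κ : Kernel ℝ ℝ) [IsSFiniteKernel κ] :
    nuOtimes μ κ = μ ⊗ₘ κ := by
  have h : (fun a => (κ a).map fun x => (a, x)) = ⇑(pushKernel κ id) :=
    funext fun a => (pushKernel_apply κ measurable_id a).symm
  ext s hs
  rw [nuOtimes, h, Measure.bind_apply hs (Kernel.aemeasurable _), Measure.compProd_apply hs]
  congr 1 with a
  rw [pushKernel_apply κ measurable_id, Measure.map_apply (by fun_prop) hs]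
  rfl

lemma compProd_pushKernel_displace (μ : Measure ℝ) [SFinite μ] (κ : Kernel ℝ ℝ)
    [IsSFiniteKernel κ] {φ : ℝ × ℝ → ℝ} (hφ : Measurable φ) (ε : ℝ) :
    nuOtimes μ (pushKernel κ fun p => p.2 + ε * φ p) = (nuOtimes μ κ).map (displace φ ε) := by
  have : IsSFiniteKernel (pushKernel κ fun p => p.2 + ε * φ p) := by
    unfold pushKernel; infer_instance
  have hT := measurable_displace hφ ε
  rw [nuOtimes_kernel, nuOtimes_kernel]
  ext s hs
  rw [Measure.compProd_apply hs, Measure.map_apply hT hs, Measure.compProd_apply (hT hs)]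
  congr 1 with a
  rw [pushKernel_apply κ (by fun_prop), Measure.map_apply (by fun_prop)
    (measurable_prodMk_left hs)]
  rfl

/-- A measurable family of measures, finite at almost every parameter, agrees almost everywhere
with an s-finite kernel. -/
lemma exists_isSFiniteKernel_ae_eq {μ : Measure ℝ} {ν : ℝ → Measure ℝ}
    (hν : ∀ s : Set ℝ, MeasurableSet s → Measurable fun a => ν a s)
    (hfin : ∀ᵐ a ∂μ, ν a Set.univ ≠ ⊤) :
    ∃ κ : Kernel ℝ ℝ, IsSFiniteKernel κ ∧ ∀ᵐ a ∂μ, κ a = ν a := by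
  classical
  let ν' : Kernel ℝ ℝ := ⟨ν, Measure.measurable_of_measurable_coe _ hν⟩
  let S : ℕ → Set ℝ := fun n => {a | ν a Set.univ ≠ ⊤ ∧ ⌊(ν a Set.univ).toReal⌋₊ = n}
  have hS : ∀ n, MeasurableSet (S n) := fun n => by
    have hu := hν Set.univ MeasurableSet.univ
    exact (hu (measurableSet_singleton ⊤)).compl.inter
      ((Nat.measurable_floor.comp hu.ennreal_toReal) (measurableSet_singleton n))
  let κ : ℕ → Kernel ℝ ℝ := fun n => Kernel.piecewise (hS n) ν' 0
  have hκ : ∀ n, IsFiniteKernel (κ n) := fun n => by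
    refine ⟨⟨ENNReal.ofReal (n + 1), ENNReal.ofReal_lt_top, fun a => ?_⟩⟩
    rw [Kernel.piecewise_apply]
    split_ifs with ha
    · change ν a Set.univ ≤ _
      rw [← ENNReal.ofReal_toReal ha.1]
      refine ENNReal.ofReal_le_ofReal ?_
      rw [← ha.2]
      exact (Nat.lt_floor_add_one _).le
    · simp
  refine ⟨Kernel.sum κ, inferInstance, hfin.mono fun a ha => ?_⟩
  ext s hs
  rw [Kernel.sum_apply' _ _ hs, tsum_eq_single ⌊(ν a Set.univ).toReal⌋₊]
  · rw [Kernel.piecewise_apply, if_pos ⟨ha, rfl⟩]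
    rfl
  · intro n hn
    rw [Kernel.piecewise_apply, if_neg fun h => hn h.2.symm]
    simp

lemma nuOtimes_congr {μ : Measure ℝ} {ν θ : ℝ → Measure ℝ} (h : ∀ᵐ a ∂μ, ν a = θ a) :
    nuOtimes μ ν = nuOtimes μ θ := by
  unfold nuOtimes Measure.bind
  congr 1
  exact Measure.map_congr (h.mono fun a ha => by simp only [ha])

/-- Testing the subdifferential against the plans induced by a displacement. -/
lemma InSubdiff.mul_integral_le {μ : Measure ℝ} [SFinite μ] {h : ℝ → ℝ} {R : ℝ} (hR : 0 < R)
    {ν : ℝ → Measure ℝ} (hν : IsXR μ h R ν) {w : ℝ → ℝ → ℝ} (hw : InSubdiff μ h ν w)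
    (κ : Kernel ℝ ℝ) [IsSFiniteKernel κ] (hκ : ∀ᵐ a ∂μ, κ a = ν a)
    {φ : ℝ × ℝ → ℝ} (hφ : Measurable φ) (hφ1 : ∀ p, |φ p| ≤ 1) {ε : ℝ}
    (hε : ε ∈ Set.Ioo (0 : ℝ) 1) :
    ε * ∫ p, φ p * w p.1 p.2 ∂(nuOtimes μ ν) ≤
      pairEnergy ((nuOtimes μ ν).map (displace φ ε)) - pairEnergy (nuOtimes μ ν) := by
  have hνκ : nuOtimes μ ν = nuOtimes μ κ := nuOtimes_congr (hκ.mono fun a ha => ha.symm)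
  set f : ℝ × ℝ → ℝ := fun p => p.2 + ε * φ p with hf
  set g : ℝ × ℝ → ℝ × ℝ := fun p => (p.2, p.2 + ε * φ p) with hg
  have hfm : Measurable f := by fun_prop
  have hgm : Measurable g := by fun_prop
  have hθ : IsXR μ h (R + 1) (pushKernel κ f) := by
    refine ⟨fun s hs => Kernel.measurable_coe _ hs, ?_, ?_⟩
    · filter_upwards [hκ, hν.mass] with a h1 h2
      rw [pushKernel_apply κ hfm, Measure.map_apply (by fun_prop) MeasurableSet.univ,
        Set.preimage_univ, h1, h2]
    · filter_upwards [hκ, hν.supp] with a h1 h2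
      rw [pushKernel_apply κ hfm, Measure.map_apply (by fun_prop) measurableSet_Icc.compl, h1]
      refine measure_mono_null (t := (Set.Icc (-R) R)ᶜ) (fun x hx hxR => hx ?_) h2
      have h3 := abs_le.1 (hφ1 (a, x))
      have h4 := hxR.1
      have h5 := hxR.2
      have h6 := hε.1
      have h7 := hε.2
      constructor <;> simp only [hf] <;> nlinarith
  have hγ : IsPlanFamily μ ν (pushKernel κ f) (pushKernel κ g) := by
    refine ⟨fun s hs => Kernel.measurable_coe _ hs, ?_, ?_⟩
    · filter_upwards [hκ] with a h1
      rw [pushKernel_apply κ hgm, Measure.map_map measurable_fst (by fun_prop), ← h1]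
      exact Measure.map_id
    · refine ae_of_all _ fun a => ?_
      rw [pushKernel_apply κ hgm, Measure.map_map measurable_snd (by fun_prop),
        pushKernel_apply κ hfm]
      rfl
  have key := hw.2 (R + 1) (by linarith) _ hθ _ hγ
  have hplan : ∀ a, ∫ p : ℝ × ℝ, w a p.1 * (p.2 - p.1) ∂(pushKernel κ g a) =
      ∫ x, ε * (φ (a, x) * w a x) ∂(κ a) := fun a => by
    have hemb : MeasurableEmbedding fun x => g (a, x) :=
      Measurable.measurableEmbedding (by fun_prop) fun x y hxy => congrArg Prod.fst hxy
    rw [pushKernel_apply κ hgm, hemb.integral_map]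
    congr 1 with x
    simp only [hg]
    ring
  have hint : Integrable (fun p : ℝ × ℝ => φ p * w p.1 p.2) (μ ⊗ₘ κ) := by
    rw [← nuOtimes_kernel, ← hνκ]
    exact hw.1.bdd_mul (c := 1) hφ.aestronglyMeasurable (ae_of_all _ hφ1)
  simp only [hplan] at key
  rw [← Measure.integral_compProd (f := fun p : ℝ × ℝ => ε * (φ p * w p.1 p.2))
    (hint.const_mul ε), integral_const_mul, ← nuOtimes_kernel, ← hνκ] at key
  have hJ : Jen μ (pushKernel κ f) = pairEnergy ((nuOtimes μ ν).map (displace φ ε)) := by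
    rw [hνκ, ← compProd_pushKernel_displace μ κ hφ]
    rfl
  rw [hJ] at key
  exact key

end Kernel

/-- **Elements of `∂J(ν)` satisfy the velocity constraint** (Proposition `linksys`):
if `ν ∈ X_R` and `w ∈ ∂J(ν)`, then, with `ρ = ∫_A ν^a dμ(a)`, `G(x) = ρ((−∞,x])` and
`G⁻(x) = ρ((−∞,x))`, one has `w^a(x) ∈ [G⁻(x) − a, G(x) − a]` for `ν⊗μ`-a.e. `(a,x)`;
in particular `‖w‖_{L^∞(ν⊗μ)} ≤ R_v + 2`. -/
theorem subdiff_velocity_constraint (Rv R : ℝ) (hRv : 0 < Rv) (hR : 0 < R)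
    (μ : Measure ℝ) [SigmaFinite μ] (hA : μ ((Set.Icc (-Rv) (Rv + 1))ᶜ) = 0)
    (h : ℝ → ℝ) (hh0 : ∀ a, 0 ≤ h a) (hhint : Integrable h μ) (hh1 : (∫ a, h a ∂μ) = 1)
    (ν : ℝ → Measure ℝ) (hν : IsXR μ h R ν)
    (w : ℝ → ℝ → ℝ) (hw : InSubdiff μ h ν w) :
    (∀ᵐ p : ℝ × ℝ ∂(nuOtimes μ ν),
      w p.1 p.2 ∈ Set.Icc (GcdfM μ ν p.2 - p.1) (Gcdf μ ν p.2 - p.1)) ∧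
    (∀ᵐ p : ℝ × ℝ ∂(nuOtimes μ ν), |w p.1 p.2| ≤ Rv + 2) := by
  have hfin : ∀ᵐ a ∂μ, ν a Set.univ ≠ ⊤ := hν.mass.mono fun a ha => by simp [ha]
  obtain ⟨κ, hκs, hκ⟩ := exists_isSFiniteKernel_ae_eq hν.meas hfin
  have hm : nuOtimes μ ν = μ.compProd κ :=
    (nuOtimes_congr (hκ.mono fun a ha => ha.symm)).trans (nuOtimes_kernel μ κ)
  have hprob : IsProbabilityMeasure (nuOtimes μ ν) := by
    constructor
    rw [hm, Measure.compProd_apply MeasurableSet.univ]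
    have : ∀ᵐ a ∂μ, κ a (Prod.mk a ⁻¹' Set.univ) = ENNReal.ofReal (h a) := by
      filter_upwards [hκ, hν.mass] with a h1 h2
      rw [Set.preimage_univ, h1, h2]
    rw [lintegral_congr_ae this, ← ofReal_integral_eq_lintegral_ofReal hhint (ae_of_all _ hh0),
      hh1, ENNReal.ofReal_one]
  have hbd : ∀ᵐ p : ℝ × ℝ ∂(nuOtimes μ ν),
      p.1 ∈ Set.Icc (-Rv) (Rv + 1) ∧ p.2 ∈ Set.Icc (-R) R := by
    rw [hm]
    refine Measure.ae_compProd_of_ae_ae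
      ((measurable_fst measurableSet_Icc).inter (measurable_snd measurableSet_Icc)) ?_
    have hA' : ∀ᵐ a ∂μ, a ∈ Set.Icc (-Rv) (Rv + 1) := hA
    filter_upwards [hκ, hν.supp, hA'] with a h1 h2 h3
    rw [h1]
    have h2' : ∀ᵐ x ∂(ν a), x ∈ Set.Icc (-R) R := h2
    exact h2'.mono fun x hx => ⟨h3, hx⟩
  have hx : Integrable (fun p : ℝ × ℝ => p.2) (nuOtimes μ ν) :=
    Integrable.of_bound measurable_snd.aestronglyMeasurable R
      (hbd.mono fun p hp => abs_le.2 hp.2)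
  have ha : Integrable (fun p : ℝ × ℝ => p.1) (nuOtimes μ ν) :=
    Integrable.of_bound measurable_fst.aestronglyMeasurable (Rv + 1)
      (hbd.mono fun p hp => abs_le.2 ⟨by linarith [hp.1.1], hp.1.2⟩)
  have hax : Integrable (fun p : ℝ × ℝ => (1 / 2 - p.1) * p.2) (nuOtimes μ ν) :=
    ((integrable_const _).sub ha).mul_bdd (c := R) measurable_snd.aestronglyMeasurable
      (hbd.mono fun p hp => abs_le.2 hp.2)
  have hmem : ∀ᵐ p : ℝ × ℝ ∂(nuOtimes μ ν),
      w p.1 p.2 ∈ Set.Icc (GcdfM μ ν p.2 - p.1) (Gcdf μ ν p.2 - p.1) :=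
    ae_mem_Icc_of_subgradient hx ha hax hw.1 fun φ hφ hφ1 ε hε =>
      hw.mul_integral_le hR hν κ hκ hφ hφ1 hε
  refine ⟨hmem, ?_⟩
  have hbar : IsProbabilityMeasure (barNu μ ν) :=
    Measure.isProbabilityMeasure_map measurable_snd.aemeasurable
  filter_upwards [hmem, hbd] with p hp hpb
  have h0 : 0 ≤ GcdfM μ ν p.2 := ENNReal.toReal_nonneg
  have h1 : Gcdf μ ν p.2 ≤ 1 := measureReal_le_one
  have h2 := hp.1
  have h3 := hp.2
  have h4 := hpb.1.1
  have h5 := hpb.1.2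
  exact abs_le.2 ⟨by linarith, by linarith⟩
end
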